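/- arXiv:1612.01819 — 2 statements merged into one kernel-verified Lean document; each statement's English description precedes it below -/
import Mathlib

section
/- Let a ≥ b > 0 and b ≤ r ≤ a. Then the area of the set {x ∈ ℝ² : (sphere(x,r) ∩ C(a,b)) has cardinality 4} equals 4raE(ε) − πr² − πab, where ε = √(a²−b²)/a and E(ε) = ∫₀^{π/2} √(1−ε² sin²θ) dθ. -/
open Real MeasureTheory Set Metric

noncomputable section

/-- The Euclidean plane. -/
abbrev E2 := EuclideanSpace ℝ (Fin 2)

/-- Closed elliptical region with semi-axes `a`, `b`. -/
def Kset (a b : ℝ) : Set E2 := {x | (x 0)^2 / a^2 + (x 1)^2 / b^2 ≤ 1}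

/-- The ellipse with semi-axes `a`, `b`. -/
def Cset (a b : ℝ) : Set E2 := {x | (x 0)^2 / a^2 + (x 1)^2 / b^2 = 1}

/-- Incomplete elliptic integral of the second kind `E(φ, ε)`. -/
def Einc (ε φ : ℝ) : ℝ := ∫ θ in (0:ℝ)..φ, Real.sqrt (1 - ε^2 * Real.sin θ^2)

/-- Complete elliptic integral of the second kind `E(ε)`. -/
def Ecomp (ε : ℝ) : ℝ := Einc ε (π/2)

/-- Eccentricity of the ellipse with semi-axes `a ≥ b`. -/
def ecc (a b : ℝ) : ℝ := Real.sqrt (a^2 - b^2) / a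

/-- **Area formula** with multiplicities: the number of preimages of a point under a differentiable
map is almost everywhere a measurable function, whose integral is that of the Jacobian. -/
theorem exists_measurable_ae_eq_encard_preimage {F : Type*} [NormedAddCommGroup F]
    [NormedSpace ℝ F] [FiniteDimensional ℝ F] [MeasurableSpace F] [BorelSpace F] (μ : Measure F)
    [μ.IsAddHaarMeasure] {s : Set F} {f : F → F} {f' : F → F →L[ℝ] F} (hs : MeasurableSet s)
    (hf' : ∀ x ∈ s, HasFDerivWithinAt f (f' x) s x) (hdet : Measurable fun x ↦ (f' x).det) :
    ∃ g : F → ENNReal, Measurable g ∧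
      (∀ᵐ y ∂μ, g y = ((s ∩ f ⁻¹' {y}).encard : ENNReal) ∧
        ∀ x ∈ s, f x = y → (f' x).det ≠ 0) ∧
      ∫⁻ y, g y ∂μ = ∫⁻ x in s, ENNReal.ofReal |(f' x).det| ∂μ := by
  classical
  set Z : Set F := {x | (f' x).det = 0} with hZ
  have hZm : MeasurableSet Z := hdet (measurableSet_singleton 0)
  set S : Set F := s \ Z with hS
  have hSm : MeasurableSet S := hs.diff hZm
  have hSf : ∀ x ∈ S, HasFDerivWithinAt f (f' x) S x := fun x hx ↦
    (hf' x hx.1).mono sdiff_subset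
  have hr : ∀ A : F →L[ℝ] F, ∃ c : NNReal, c ≠ 0 ∧ (A.det ≠ 0 → ∀ t : Set F,
      ApproximatesLinearOn f A t c → InjOn f t) := by
    intro A
    by_cases hA : A.det = 0
    · exact ⟨1, one_ne_zero, fun h ↦ absurd hA h⟩
    · set B := A.toContinuousLinearEquivOfDetNeZero hA with hB
      have hBA : (B : F →L[ℝ] F) = A := by ext x; simp [hB]
      rcases B.subsingleton_or_nnnorm_symm_pos with h | h
      · exact ⟨1, one_ne_zero, fun _ t _ x _ y _ _ ↦ Subsingleton.elim x y⟩
      · have hp : 0 < ‖(B.symm : F →L[ℝ] F)‖₊⁻¹ := inv_pos.2 h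
        refine ⟨‖(B.symm : F →L[ℝ] F)‖₊⁻¹ / 2, (half_pos hp).ne', fun _ t ht ↦ ?_⟩
        rw [← hBA] at ht
        exact ht.injOn (Or.inr (half_lt_self hp))
  choose c hc0 hc using hr
  obtain ⟨t, A, htd, htm, hcov, happ, hA⟩ :=
    exists_partition_approximatesLinearOn_of_hasFDerivWithinAt f S f' hSf c hc0
  have hinj : ∀ n, InjOn f (S ∩ t n) := by
    intro n
    rcases S.eq_empty_or_nonempty with h | h
    · simp [h]
    · obtain ⟨y, hy, hAy⟩ := hA h n
      exact hc (A n) (by rw [hAy]; exact hy.2) _ (happ n)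
  have hm : ∀ n, MeasurableSet (S ∩ t n) := fun n ↦ hSm.inter (htm n)
  have hfd : ∀ n, ∀ x ∈ S ∩ t n, HasFDerivWithinAt f (f' x) (S ∩ t n) x := fun n x hx ↦
    (hSf x hx.1).mono inter_subset_left
  have him : ∀ n, MeasurableSet (f '' (S ∩ t n)) := fun n ↦
    measurable_image_of_fderivWithin (hm n) (hfd n) (hinj n)
  have hSU : S = ⋃ n, S ∩ t n := by
    rw [← inter_iUnion, inter_eq_left.2 hcov]
  have hdisj : Pairwise (Function.onFun Disjoint fun n ↦ S ∩ t n) := fun i j hij ↦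
    (htd hij).mono inter_subset_right inter_subset_right
  refine ⟨fun y ↦ ∑' n, (f '' (S ∩ t n)).indicator 1 y,
    Measurable.tsum fun n ↦ measurable_one.indicator (him n), ?_, ?_⟩
  · have hnull : μ (f '' (s ∩ Z)) = 0 :=
      addHaar_image_eq_zero_of_det_fderivWithin_eq_zero μ
        (fun x hx ↦ (hf' x hx.1).mono inter_subset_left) (fun x hx ↦ hx.2)
    filter_upwards [compl_mem_ae_iff.2 hnull] with y hy
    have hreg : ∀ x ∈ s, f x = y → (f' x).det ≠ 0 := fun x hx hxy h0 ↦ hy ⟨x, ⟨hx, h0⟩, hxy⟩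
    refine ⟨?_, hreg⟩
    have h1 : s ∩ f ⁻¹' {y} = ⋃ n, (S ∩ t n) ∩ f ⁻¹' {y} := by
      rw [← iUnion_inter, ← hSU]
      ext x
      constructor
      · rintro ⟨hx, hxy⟩
        exact ⟨⟨hx, hreg x hx hxy⟩, hxy⟩
      · rintro ⟨hx, hxy⟩
        exact ⟨hx.1, hxy⟩
    have hsub : ∀ n, ((S ∩ t n) ∩ f ⁻¹' {y}).Subsingleton := fun n x hx z hz ↦
      hinj n hx.1 hz.1 (hx.2.trans hz.2.symm)
    have hmeas : ∀ n, MeasurableSet ((S ∩ t n) ∩ f ⁻¹' {y}) := fun n ↦ (hsub n).measurableSet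
    rw [h1, ← Measure.count_apply (MeasurableSet.iUnion hmeas),
      measure_iUnion (fun i j hij ↦ (hdisj hij).mono inter_subset_left inter_subset_left) hmeas]
    refine tsum_congr fun n ↦ ?_
    rw [Measure.count_apply (hmeas n)]
    by_cases hyn : y ∈ f '' (S ∩ t n)
    · obtain ⟨x, hx, hxy⟩ := id hyn
      have : (S ∩ t n) ∩ f ⁻¹' {y} = {x} :=
        (hsub n).eq_singleton_of_mem ⟨hx, hxy⟩
      rw [this, indicator_of_mem hyn]
      simp
    · have : (S ∩ t n) ∩ f ⁻¹' {y} = ∅ :=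
        eq_empty_of_forall_notMem fun x hx ↦ hyn ⟨x, hx.1, hx.2⟩
      rw [this, indicator_of_notMem hyn]
      simp
  · rw [lintegral_tsum fun n ↦ (measurable_one.indicator (him n)).aemeasurable]
    have h2 : ∀ n, ∫⁻ y, (f '' (S ∩ t n)).indicator 1 y ∂μ =
        ∫⁻ x in S ∩ t n, ENNReal.ofReal |(f' x).det| ∂μ := fun n ↦ by
      rw [lintegral_indicator_one (him n),
        lintegral_abs_det_fderiv_eq_addHaar_image μ (hm n) (hfd n) (hinj n)]
    simp_rw [h2]
    rw [← lintegral_iUnion hm hdisj, ← hSU]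
    have h3 := lintegral_inter_add_sdiff (μ := μ) (fun x ↦ ENNReal.ofReal |(f' x).det|) s hZm
    rw [← h3]
    have h4 : ∫⁻ x in s ∩ Z, ENNReal.ofReal |(f' x).det| ∂μ = 0 := by
      rw [setLIntegral_congr_fun (g := fun _ ↦ 0) (hs.inter hZm)]
      · simp
      · intro x hx
        have : (f' x).det = 0 := hx.2
        simp [this]
    rw [h4, zero_add]

theorem exists_root_cubic {c₃ c₂ c₁ c₀ : ℝ} (h : c₃ ≠ 0) :
    ∃ t, c₃ * t ^ 3 + c₂ * t ^ 2 + c₁ * t + c₀ = 0 := by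
  obtain ⟨p, rfl⟩ : ∃ p, c₂ = c₃ * p := ⟨c₂ / c₃, by field_simp⟩
  obtain ⟨q, rfl⟩ : ∃ p, c₁ = c₃ * p := ⟨c₁ / c₃, by field_simp⟩
  obtain ⟨s, rfl⟩ : ∃ p, c₀ = c₃ * p := ⟨c₀ / c₃, by field_simp⟩
  have hp := abs_nonneg p
  have hq := abs_nonneg q
  have hs := abs_nonneg s
  have bp := abs_le.1 (le_refl |p|)
  have bq := abs_le.1 (le_refl |q|)
  have bs := abs_le.1 (le_refl |s|)
  set R : ℝ := 1 + |p| + |q| + |s| with hR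
  have hR1 : 1 ≤ R := by linarith
  have hRp : R ^ 3 = R ^ 2 + |p| * R ^ 2 + |q| * R ^ 2 + |s| * R ^ 2 := by
    calc R ^ 3 = R ^ 2 * R := by ring
      _ = R ^ 2 * (1 + |p| + |q| + |s|) := by rw [← hR]
      _ = _ := by ring
  have h1 : |p| * R ^ 2 + p * R ^ 2 ≥ 0 := by nlinarith [sq_nonneg R]
  have h1' : |p| * R ^ 2 - p * R ^ 2 ≥ 0 := by nlinarith [sq_nonneg R]
  have h2 : |q| * R ^ 2 ≥ |q| * R := by nlinarith [mul_nonneg hq (by linarith : 0 ≤ R)]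
  have h2' : |q| * R + q * R ≥ 0 := by nlinarith
  have h3 : |s| * R ^ 2 ≥ |s| := by nlinarith [mul_nonneg hs (by linarith : 0 ≤ R)]
  have hc : ContinuousOn (fun t : ℝ ↦ t ^ 3 + p * t ^ 2 + q * t + s) (Icc (-R) R) := by fun_prop
  have h0 : (0 : ℝ) ∈ Icc ((-R) ^ 3 + p * (-R) ^ 2 + q * (-R) + s)
      (R ^ 3 + p * R ^ 2 + q * R + s) := by
    constructor <;> nlinarith
  obtain ⟨t, -, ht⟩ := intermediate_value_Icc (by linarith) hc h0
  refine ⟨t, ?_⟩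
  have ht' : t ^ 3 + p * t ^ 2 + q * t + s = 0 := ht
  linear_combination c₃ * ht'

/-- A real quartic polynomial without multiple real roots has `0`, `2` or `4` real roots. -/
theorem encard_roots_quartic {c₄ c₃ c₂ c₁ c₀ : ℝ} (h : c₄ ≠ 0)
    (hs : ∀ t, c₄ * t ^ 4 + c₃ * t ^ 3 + c₂ * t ^ 2 + c₁ * t + c₀ = 0 →
      4 * c₄ * t ^ 3 + 3 * c₃ * t ^ 2 + 2 * c₂ * t + c₁ ≠ 0) :
    {t | c₄ * t ^ 4 + c₃ * t ^ 3 + c₂ * t ^ 2 + c₁ * t + c₀ = 0}.encard = 0 ∨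
    {t | c₄ * t ^ 4 + c₃ * t ^ 3 + c₂ * t ^ 2 + c₁ * t + c₀ = 0}.encard = 2 ∨
    {t | c₄ * t ^ 4 + c₃ * t ^ 3 + c₂ * t ^ 2 + c₁ * t + c₀ = 0}.encard = 4 := by
  rcases eq_empty_or_nonempty
    {t | c₄ * t ^ 4 + c₃ * t ^ 3 + c₂ * t ^ 2 + c₁ * t + c₀ = 0} with h0 | ⟨t₁, h1⟩
  · left
    rw [h0, encard_empty]
  right
  have h1' : c₄ * t₁ ^ 4 + c₃ * t₁ ^ 3 + c₂ * t₁ ^ 2 + c₁ * t₁ + c₀ = 0 := h1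
  obtain ⟨t₂, h2⟩ := exists_root_cubic (c₃ := c₄) (c₂ := c₃ + c₄ * t₁)
    (c₁ := c₂ + (c₃ + c₄ * t₁) * t₁) (c₀ := c₁ + (c₂ + (c₃ + c₄ * t₁) * t₁) * t₁) h
  set e₁ : ℝ := c₃ + c₄ * t₁ + c₄ * t₂ with he₁
  set e₀ : ℝ := c₂ + (c₃ + c₄ * t₁) * t₁ + e₁ * t₂ with he₀
  have hfac : ∀ t, c₄ * t ^ 4 + c₃ * t ^ 3 + c₂ * t ^ 2 + c₁ * t + c₀ =
      (t - t₁) * (t - t₂) * (c₄ * t ^ 2 + e₁ * t + e₀) := by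
    intro t
    rw [he₀, he₁]
    linear_combination h1' + (t - t₁) * h2
  have hder : ∀ t, 4 * c₄ * t ^ 3 + 3 * c₃ * t ^ 2 + 2 * c₂ * t + c₁ =
      (t - t₂) * (c₄ * t ^ 2 + e₁ * t + e₀) + (t - t₁) * (c₄ * t ^ 2 + e₁ * t + e₀) +
      (t - t₁) * (t - t₂) * (2 * c₄ * t + e₁) := by
    intro t
    rw [he₀, he₁]
    linear_combination h2
  simp_rw [hfac] at hs ⊢
  simp_rw [hder] at hs
  have h12 : t₁ ≠ t₂ := by
    intro h12
    refine hs t₁ (by ring) ?_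
    rw [h12]
    ring
  rcases eq_empty_or_nonempty {t | c₄ * t ^ 2 + e₁ * t + e₀ = 0} with h3 | ⟨t₃, h3⟩
  · left
    have : {t | (t - t₁) * (t - t₂) * (c₄ * t ^ 2 + e₁ * t + e₀) = 0} = {t₁, t₂} := by
      ext t
      have : c₄ * t ^ 2 + e₁ * t + e₀ ≠ 0 := fun ht ↦ (h3 ▸ ht : t ∈ (∅ : Set ℝ))
      simp [this, sub_eq_zero]
    rw [this, encard_pair h12]
  · right
    have h3' : c₄ * t₃ ^ 2 + e₁ * t₃ + e₀ = 0 := h3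
    obtain ⟨t₄, h4⟩ : ∃ t₄, e₁ = -c₄ * (t₃ + t₄) := ⟨-e₁ / c₄ - t₃, by field_simp; ring⟩
    have h5 : e₀ = c₄ * t₃ * t₄ := by rw [h4] at h3'; linear_combination h3'
    have hq : ∀ t, c₄ * t ^ 2 + e₁ * t + e₀ = c₄ * ((t - t₃) * (t - t₄)) := by
      intro t
      rw [h5, h4]
      ring
    simp_rw [hq] at hs ⊢
    rw [h4] at hs
    have h13 : t₁ ≠ t₃ := by rintro rfl; exact hs t₁ (by ring) (by ring)
    have h14 : t₁ ≠ t₄ := by rintro rfl; exact hs t₁ (by ring) (by ring)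
    have h23 : t₂ ≠ t₃ := by rintro rfl; exact hs t₂ (by ring) (by ring)
    have h24 : t₂ ≠ t₄ := by rintro rfl; exact hs t₂ (by ring) (by ring)
    have h34 : t₃ ≠ t₄ := by rintro rfl; exact hs t₃ (by ring) (by ring)
    have : {t | (t - t₁) * (t - t₂) * (c₄ * ((t - t₃) * (t - t₄))) = 0} = {t₁, t₂, t₃, t₄} := by
      ext t
      simp [h, sub_eq_zero, or_assoc]
    rw [this, encard_insert_of_notMem (by simp [h12, h13, h14]),
      encard_insert_of_notMem (by simp [h23, h24]), encard_pair h34]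
    norm_num

/-- The intersection of the ellipse with semi-axes `a`, `b` and the circle of radius `r` around
`x`, in coordinates. -/
def ellipseInterCircle (a b r : ℝ) (x : ℝ × ℝ) : Set (ℝ × ℝ) :=
  {p | p.1 ^ 2 / a ^ 2 + p.2 ^ 2 / b ^ 2 = 1 ∧ (p.1 - x.1) ^ 2 + (p.2 - x.2) ^ 2 = r ^ 2}

/-- A circle that meets an ellipse transversally and misses one vertex of the major axis meets it
in `0`, `2` or `4` points. -/
theorem encard_ellipseInterCircle {a b r : ℝ} (ha : 0 < a) (hb : 0 < b) {x : ℝ × ℝ}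
    (hv : (-a, 0) ∉ ellipseInterCircle a b r x)
    (ht : ∀ p ∈ ellipseInterCircle a b r x,
      b ^ 2 * p.1 * (x.2 - p.2) - a ^ 2 * p.2 * (x.1 - p.1) ≠ 0) :
    (ellipseInterCircle a b r x).encard = 0 ∨ (ellipseInterCircle a b r x).encard = 2 ∨
      (ellipseInterCircle a b r x).encard = 4 := by
  obtain ⟨u, v⟩ := x
  simp only at ht
  set c₄ : ℝ := (a + u) ^ 2 + v ^ 2 - r ^ 2 with hc₄
  set c₃ : ℝ := -4 * b * v with hc₃
  set c₂ : ℝ := -2 * (a - u) * (a + u) + 4 * b ^ 2 + 2 * v ^ 2 - 2 * r ^ 2 with hc₂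
  set c₁ : ℝ := -4 * b * v with hc₁
  set c₀ : ℝ := (a - u) ^ 2 + v ^ 2 - r ^ 2 with hc₀
  set P : ℝ → ℝ × ℝ := fun t ↦ (a * (1 - t ^ 2) / (1 + t ^ 2), 2 * b * t / (1 + t ^ 2)) with hP
  have hpos : ∀ t : ℝ, 0 < 1 + t ^ 2 := fun t ↦ by positivity
  have hPE : ∀ t, (P t).1 ^ 2 / a ^ 2 + (P t).2 ^ 2 / b ^ 2 = 1 := by
    intro t
    have := (hpos t).ne'
    simp only [hP]
    field_simp
    ring
  have hPS : ∀ t, ((P t).1 - u) ^ 2 + ((P t).2 - v) ^ 2 - r ^ 2 =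
      (c₄ * t ^ 4 + c₃ * t ^ 3 + c₂ * t ^ 2 + c₁ * t + c₀) / (1 + t ^ 2) ^ 2 := by
    intro t
    have := (hpos t).ne'
    simp only [hP, hc₄, hc₃, hc₂, hc₁, hc₀]
    field_simp
    ring
  have hmem : ∀ t, P t ∈ ellipseInterCircle a b r (u, v) ↔
      c₄ * t ^ 4 + c₃ * t ^ 3 + c₂ * t ^ 2 + c₁ * t + c₀ = 0 := by
    intro t
    have h1 : P t ∈ ellipseInterCircle a b r (u, v) ↔
        ((P t).1 - u) ^ 2 + ((P t).2 - v) ^ 2 - r ^ 2 = 0 := by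
      simp only [ellipseInterCircle, mem_ofPred_eq, hPE, true_and, sub_eq_zero]
    rw [h1, hPS, div_eq_zero_iff, or_iff_left (pow_pos (hpos t) 2).ne']
  have hinj : Function.Injective P := by
    have hl : ∀ t, (P t).2 / b / (1 + (P t).1 / a) = t := by
      intro t
      have := (hpos t).ne'
      have h2 : 1 + (P t).1 / a = 2 / (1 + t ^ 2) := by
        simp only [hP]
        field_simp
        ring
      rw [h2]
      simp only [hP]
      field_simp
    intro s t hst
    rw [← hl s, hst, hl]
  have himage : ellipseInterCircle a b r (u, v) =
      P '' {t | c₄ * t ^ 4 + c₃ * t ^ 3 + c₂ * t ^ 2 + c₁ * t + c₀ = 0} := by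
    ext ⟨p, q⟩
    constructor
    · intro hp
      have h1 : p ^ 2 / a ^ 2 + q ^ 2 / b ^ 2 = 1 := hp.1
      have h2 : a + p ≠ 0 := by
        intro h
        have hpa : p = -a := by linarith
        have hq : q = 0 := by
          rw [hpa] at h1
          field_simp at h1
          nlinarith
        exact hv (by rw [← hpa, ← hq]; exact hp)
      have h3 : P (a * q / (b * (a + p))) = (p, q) := by
        have h4 : q ^ 2 * a ^ 2 = b ^ 2 * (a - p) * (a + p) := by
          field_simp at h1
          linear_combination h1
        have h6 : (a * q / (b * (a + p))) ^ 2 = (a - p) / (a + p) := by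
          field_simp
          linear_combination h4
        simp only [hP, h6, Prod.mk.injEq]
        have h7 : 1 + (a - p) / (a + p) = 2 * a / (a + p) := by
          field_simp
          ring
        have h8 : 1 - (a - p) / (a + p) = 2 * p / (a + p) := by
          field_simp
          ring
        rw [h7, h8]
        constructor <;> field_simp
      exact ⟨_, (hmem _).1 (h3 ▸ hp), h3⟩
    · rintro ⟨t, ht, htp⟩
      rw [← htp]
      exact (hmem t).2 ht
  rw [himage, hinj.encard_image]
  apply encard_roots_quartic
  · intro h
    apply hv
    simp only [ellipseInterCircle, mem_ofPred_eq]
    constructor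
    · field_simp
      simp
    · linear_combination h
  · intro t h0 h1
    refine ht (P t) ((hmem t).2 h0) ?_
    have := (hpos t).ne'
    have h2 : b ^ 2 * (P t).1 * (v - (P t).2) - a ^ 2 * (P t).2 * (u - (P t).1) =
        -(a * b / 4) * ((1 + t ^ 2) * (4 * c₄ * t ^ 3 + 3 * c₃ * t ^ 2 + 2 * c₂ * t + c₁) -
          4 * t * (c₄ * t ^ 4 + c₃ * t ^ 3 + c₂ * t ^ 2 + c₁ * t + c₀)) / (1 + t ^ 2) ^ 2 := by
      simp only [hP, hc₄, hc₃, hc₂, hc₁, hc₀]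
      field_simp
      ring
    rw [h2, h0, h1]
    ring

/-- The linear endomorphism of the plane with matrix `!![α, β; γ, δ]`. -/
def planeLin (α β γ δ : ℝ) : ℝ × ℝ →L[ℝ] ℝ × ℝ :=
  (Matrix.toLin (.finTwoProd ℝ) (.finTwoProd ℝ) !![α, β; γ, δ]).toContinuousLinearMap

theorem det_planeLin (α β γ δ : ℝ) : (planeLin α β γ δ).det = α * δ - β * γ := by
  unfold planeLin
  simp only [LinearMap.det_toContinuousLinearMap, LinearMap.det_toLin, Matrix.det_fin_two_of]

theorem hasFDerivAt_planeLin {f g : ℝ × ℝ → ℝ} {α β γ δ : ℝ} {p : ℝ × ℝ}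
    (hf : HasFDerivAt f (α • ContinuousLinearMap.fst ℝ ℝ ℝ + β • ContinuousLinearMap.snd ℝ ℝ ℝ) p)
    (hg : HasFDerivAt g (γ • ContinuousLinearMap.fst ℝ ℝ ℝ + δ • ContinuousLinearMap.snd ℝ ℝ ℝ) p) :
    HasFDerivAt (fun q ↦ (f q, g q)) (planeLin α β γ δ) p := by
  unfold planeLin
  rw [Matrix.toLin_finTwoProd_toContinuousLinearMap]
  exact hf.prodMk hg

theorem HasDerivAt.hasFDerivAt_comp_fst {f : ℝ → ℝ} {f' : ℝ} {q : ℝ × ℝ}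
    (hf : HasDerivAt f f' q.1) :
    HasFDerivAt (fun q : ℝ × ℝ ↦ f q.1) (f' • ContinuousLinearMap.fst ℝ ℝ ℝ) q :=
  HasDerivAt.comp_hasFDerivAt (f := Prod.fst) q hf hasFDerivAt_fst

theorem HasDerivAt.hasFDerivAt_comp_snd {f : ℝ → ℝ} {f' : ℝ} {q : ℝ × ℝ}
    (hf : HasDerivAt f f' q.2) :
    HasFDerivAt (fun q : ℝ × ℝ ↦ f q.2) (f' • ContinuousLinearMap.snd ℝ ℝ ℝ) q :=
  HasDerivAt.comp_hasFDerivAt (f := Prod.snd) q hf hasFDerivAt_snd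

theorem exists_mem_Ioc_cos_sin {c s : ℝ} (h : c ^ 2 + s ^ 2 = 1) :
    ∃ θ ∈ Ioc (-π) π, Real.cos θ = c ∧ Real.sin θ = s := by
  have hn : ‖(⟨c, s⟩ : ℂ)‖ = 1 := by
    rw [Complex.norm_def, Complex.normSq_mk, ← sq, ← sq, h, Real.sqrt_one]
  have h0 : (⟨c, s⟩ : ℂ) ≠ 0 := by
    intro h0
    rw [h0, norm_zero] at hn
    exact zero_ne_one hn
  refine ⟨Complex.arg ⟨c, s⟩, Complex.arg_mem_Ioc _, ?_, ?_⟩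
  · rw [Complex.cos_arg h0, hn, div_one]
  · rw [Complex.sin_arg, hn, div_one]

theorem eq_of_cos_eq_sin_eq {θ ψ : ℝ} (hθ : θ ∈ Ioc (-π) π) (hψ : ψ ∈ Ioc (-π) π)
    (hc : Real.cos θ = Real.cos ψ) (hs : Real.sin θ = Real.sin ψ) : θ = ψ := by
  rw [← Real.Angle.toReal_coe_eq_self_iff.2 hθ, ← Real.Angle.toReal_coe_eq_self_iff.2 hψ,
    Real.Angle.cos_sin_inj hc hs]

/-- The sum of a point of the ellipse with semi-axes `a`, `b` and a point of the circle of radius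
`r` around the origin, as a function of their angular parameters. -/
def ellipseAddCircle (a b r : ℝ) (q : ℝ × ℝ) : ℝ × ℝ :=
  (a * Real.cos q.1 + r * Real.cos q.2, b * Real.sin q.1 + r * Real.sin q.2)

theorem hasFDerivAt_ellipseAddCircle (a b r : ℝ) (q : ℝ × ℝ) :
    HasFDerivAt (ellipseAddCircle a b r)
      (planeLin (-a * Real.sin q.1) (-r * Real.sin q.2) (b * Real.cos q.1) (r * Real.cos q.2)) q := by
  apply hasFDerivAt_planeLin
  · convert! ((Real.hasDerivAt_cos q.1).const_mul a).hasFDerivAt_comp_fst.add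
      ((Real.hasDerivAt_cos q.2).const_mul r).hasFDerivAt_comp_snd using 2 <;> simp
  · exact ((Real.hasDerivAt_sin q.1).const_mul b).hasFDerivAt_comp_fst.add
      ((Real.hasDerivAt_sin q.2).const_mul r).hasFDerivAt_comp_snd

theorem encard_preimage_ellipseAddCircle {a b r : ℝ} (ha : 0 < a) (hb : 0 < b) (hr : 0 < r)
    (x : ℝ × ℝ) :
    (Ioc (-π) π ×ˢ Ioc (-π) π ∩ ellipseAddCircle a b r ⁻¹' {x}).encard =
      (ellipseInterCircle a b r x).encard := by
  have hinj : InjOn (fun q : ℝ × ℝ ↦ (a * Real.cos q.1, b * Real.sin q.1))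
      (Ioc (-π) π ×ˢ Ioc (-π) π ∩ ellipseAddCircle a b r ⁻¹' {x}) := by
    rintro ⟨θ, φ⟩ ⟨⟨hθ, hφ⟩, h⟩ ⟨θ', φ'⟩ ⟨⟨hθ', hφ'⟩, h'⟩ hq
    simp only [Prod.mk.injEq, mul_right_inj' ha.ne', mul_right_inj' hb.ne'] at hq
    have hθθ : θ = θ' := eq_of_cos_eq_sin_eq hθ hθ' hq.1 hq.2
    have hx : ellipseAddCircle a b r (θ, φ) = ellipseAddCircle a b r (θ', φ') := h.trans h'.symm
    subst hθθ
    simp only [ellipseAddCircle, Prod.mk.injEq, add_right_inj, mul_right_inj' hr.ne'] at hx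
    exact congrArg (Prod.mk θ) (eq_of_cos_eq_sin_eq hφ hφ' hx.1 hx.2)
  rw [← hinj.encard_image]
  congr 1
  ext ⟨p₁, p₂⟩
  constructor
  · rintro ⟨⟨θ, φ⟩, ⟨-, rfl⟩, hq⟩
    simp only [Prod.mk.injEq] at hq
    obtain ⟨rfl, rfl⟩ := hq
    simp only [ellipseInterCircle, ellipseAddCircle, mem_ofPred_eq]
    constructor
    · field_simp
      exact Real.cos_sq_add_sin_sq θ
    · linear_combination r ^ 2 * Real.cos_sq_add_sin_sq φ
  · rintro ⟨h1, h2⟩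
    simp only at h1 h2
    obtain ⟨θ, hθ, hc, hs⟩ := exists_mem_Ioc_cos_sin (c := p₁ / a) (s := p₂ / b)
      (by rw [div_pow, div_pow, h1])
    obtain ⟨φ, hφ, hc', hs'⟩ := exists_mem_Ioc_cos_sin (c := (x.1 - p₁) / r) (s := (x.2 - p₂) / r)
      (by field_simp; linear_combination h2)
    refine ⟨(θ, φ), ⟨⟨hθ, hφ⟩, ?_⟩, ?_⟩
    · simp only [mem_preimage, mem_singleton_iff, ellipseAddCircle]
      ext
      · simp only [hc, hc']
        field_simp
        ring
      · simp only [hs, hs']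
        field_simp
        ring
    · simp only [hc, hs]
      ext <;> field_simp

theorem ae_vertex_notMem {a b r : ℝ} (hr : 0 < r) :
    ∀ᵐ x : ℝ × ℝ, (-a, 0) ∉ ellipseInterCircle a b r x := by
  have hnull : volume (ellipseAddCircle a b r '' ({π} ×ˢ univ)) = 0 := by
    apply addHaar_image_eq_zero_of_differentiableOn_of_addHaar_eq_zero
    · exact fun q _ ↦ (hasFDerivAt_ellipseAddCircle a b r q).differentiableAt.differentiableWithinAt
    · rw [Measure.volume_eq_prod, Measure.prod_prod]
      simp
  filter_upwards [compl_mem_ae_iff.2 hnull] with x hx hmem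
  apply hx
  have h2 : (-a - x.1) ^ 2 + (0 - x.2) ^ 2 = r ^ 2 := hmem.2
  obtain ⟨φ, -, hc, hs⟩ := exists_mem_Ioc_cos_sin (c := (x.1 + a) / r) (s := x.2 / r)
    (by field_simp; linear_combination h2)
  refine ⟨(π, φ), ⟨rfl, mem_univ _⟩, ?_⟩
  ext
  · simp only [ellipseAddCircle, hc, Real.cos_pi]
    field_simp
    ring
  · simp only [ellipseAddCircle, hs, Real.sin_pi]
    field_simp
    ring

/-- Almost every circle of radius `r` meets the ellipse in `0`, `2` or `4` points, and the integral
over the centre of the number of intersection points is that of a Jacobian over the torus. -/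
theorem exists_measurable_ae_eq_encard_ellipseInterCircle {a b r : ℝ} (ha : 0 < a) (hb : 0 < b)
    (hr : 0 < r) :
    ∃ g : ℝ × ℝ → ENNReal, Measurable g ∧
      (∀ᵐ x, g x = ((ellipseInterCircle a b r x).encard : ENNReal) ∧
        ((ellipseInterCircle a b r x).encard = 0 ∨ (ellipseInterCircle a b r x).encard = 2 ∨
          (ellipseInterCircle a b r x).encard = 4)) ∧
      ∫⁻ x, g x = ∫⁻ q in Ioc (-π) π ×ˢ Ioc (-π) π, ENNReal.ofReal
        (r * |-a * Real.sin q.1 * Real.cos q.2 + b * Real.cos q.1 * Real.sin q.2|) := by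
  have hdet : ∀ q : ℝ × ℝ, (planeLin (-a * Real.sin q.1) (-r * Real.sin q.2) (b * Real.cos q.1)
      (r * Real.cos q.2)).det =
      r * (-a * Real.sin q.1 * Real.cos q.2 + b * Real.cos q.1 * Real.sin q.2) := by
    intro q
    rw [det_planeLin]
    ring
  obtain ⟨g, hg, hga, hgi⟩ := exists_measurable_ae_eq_encard_preimage volume
    (measurableSet_Ioc.prod measurableSet_Ioc : MeasurableSet (Ioc (-π) π ×ˢ Ioc (-π) π))
    (fun q _ ↦ (hasFDerivAt_ellipseAddCircle a b r q).hasFDerivWithinAt)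
    (by simp_rw [hdet]; fun_prop)
  refine ⟨g, hg, ?_, ?_⟩
  · filter_upwards [hga, ae_vertex_notMem (a := a) (b := b) hr] with x hx hv
    rw [hx.1, encard_preimage_ellipseAddCircle ha hb hr]
    refine ⟨rfl, encard_ellipseInterCircle ha hb hv ?_⟩
    rintro ⟨p₁, p₂⟩ ⟨h1, h2⟩ h0
    simp only at h1 h2 h0
    obtain ⟨θ, hθ, hc, hs⟩ := exists_mem_Ioc_cos_sin (c := p₁ / a) (s := p₂ / b)
      (by rw [div_pow, div_pow, h1])
    obtain ⟨φ, hφ, hc', hs'⟩ := exists_mem_Ioc_cos_sin (c := (x.1 - p₁) / r) (s := (x.2 - p₂) / r)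
      (by field_simp; linear_combination h2)
    refine hx.2 (θ, φ) ⟨hθ, hφ⟩ ?_ ?_
    · simp only [ellipseAddCircle]
      ext
      · simp only [hc, hc']
        field_simp
        ring
      · simp only [hs, hs']
        field_simp
        ring
    · rw [hdet]
      simp only [hc, hs, hc', hs']
      field_simp
      linear_combination h0
  · rw [hgi]
    simp_rw [hdet, abs_mul, abs_of_pos hr]

/-- The speed of the parametrization `θ ↦ (a cos θ, b sin θ)` of the ellipse. -/
def ellipseSpeed (a b θ : ℝ) : ℝ := √(b ^ 2 * Real.cos θ ^ 2 + a ^ 2 * Real.sin θ ^ 2)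

theorem ellipseSpeed_sq (a b θ : ℝ) :
    ellipseSpeed a b θ ^ 2 = b ^ 2 * Real.cos θ ^ 2 + a ^ 2 * Real.sin θ ^ 2 :=
  Real.sq_sqrt (by positivity)

theorem le_ellipseSpeed {a b : ℝ} (hb : 0 < b) (hab : b ≤ a) (θ : ℝ) : b ≤ ellipseSpeed a b θ := by
  apply Real.le_sqrt_of_sq_le
  nlinarith [Real.cos_sq_add_sin_sq θ, mul_le_mul hab hab hb.le (hb.le.trans hab),
    sq_nonneg (Real.sin θ)]

theorem ellipseSpeed_le {a b : ℝ} (hb : 0 < b) (hab : b ≤ a) (θ : ℝ) : ellipseSpeed a b θ ≤ a := by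
  apply Real.sqrt_le_iff.2 ⟨hb.le.trans hab, ?_⟩
  nlinarith [Real.cos_sq_add_sin_sq θ, mul_le_mul hab hab hb.le (hb.le.trans hab),
    sq_nonneg (Real.cos θ)]

theorem continuous_ellipseSpeed (a b : ℝ) : Continuous (ellipseSpeed a b) := by
  unfold ellipseSpeed
  fun_prop

/-- The point on the normal of the ellipse at `(a cos θ, b sin θ)` that differs from that point by
`l` times the normal vector `(cos θ / a, sin θ / b)`; here `q = (θ, l)`. -/
def ellipseNormalPoint (a b : ℝ) (q : ℝ × ℝ) : ℝ × ℝ :=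
  (Real.cos q.1 * (a + q.2 / a), Real.sin q.1 * (b + q.2 / b))

theorem hasFDerivAt_ellipseNormalPoint (a b : ℝ) (q : ℝ × ℝ) :
    HasFDerivAt (ellipseNormalPoint a b)
      (planeLin (-Real.sin q.1 * (a + q.2 / a)) (Real.cos q.1 * a⁻¹)
        (Real.cos q.1 * (b + q.2 / b)) (Real.sin q.1 * b⁻¹)) q := by
  have h : ∀ c : ℝ, HasDerivAt (fun l : ℝ ↦ c + l / c) c⁻¹ q.2 := fun c ↦ by
    simpa using ((hasDerivAt_id q.2).div_const c).const_add c
  apply hasFDerivAt_planeLin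
  · convert! (Real.hasDerivAt_cos q.1).hasFDerivAt_comp_fst.mul
      (h a).hasFDerivAt_comp_snd using 1
    ext <;> simp [mul_comm]
  · convert! (Real.hasDerivAt_sin q.1).hasFDerivAt_comp_fst.mul
      (h b).hasFDerivAt_comp_snd using 1
    ext <;> simp [mul_comm]

/-- For `l > -b²`, the point `(a cos θ, b sin θ)` is the point of the ellipse nearest to
`ellipseNormalPoint a b (θ, l)`, in the following quantitative form. -/
theorem sq_dist_ellipseNormalPoint {a b : ℝ} (ha : 0 < a) (hb : 0 < b) (q : ℝ × ℝ) {p : ℝ × ℝ}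
    (hp : p.1 ^ 2 / a ^ 2 + p.2 ^ 2 / b ^ 2 = 1) :
    (p.1 - (ellipseNormalPoint a b q).1) ^ 2 + (p.2 - (ellipseNormalPoint a b q).2) ^ 2 =
      (q.2 * ellipseSpeed a b q.1 / (a * b)) ^ 2 +
      (1 + q.2 / a ^ 2) * (p.1 - a * Real.cos q.1) ^ 2 +
      (1 + q.2 / b ^ 2) * (p.2 - b * Real.sin q.1) ^ 2 := by
  rw [div_pow, mul_pow, ellipseSpeed_sq]
  have hcs := Real.cos_sq_add_sin_sq q.1
  simp only [ellipseNormalPoint]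
  field_simp
  field_simp at hp
  linear_combination (q.2 * a ^ 2 * b ^ 2) * hcs - q.2 * hp

/-- The parameters `(θ, l)` of the points off the major axis with distance at most `r` from the
ellipse, `(a cos θ, b sin θ)` being the nearest point of the ellipse. -/
def ellipseNearParams (a b r : ℝ) : Set (ℝ × ℝ) :=
  {q | q.1 ∈ Ioc (-π) π ∧ Real.sin q.1 ≠ 0 ∧ -b ^ 2 < q.2 ∧ q.2 * ellipseSpeed a b q.1 ≤ r * a * b}

theorem injOn_ellipseNormalPoint {a b r : ℝ} (hb : 0 < b) (hab : b ≤ a) :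
    InjOn (ellipseNormalPoint a b) (ellipseNearParams a b r) := by
  have ha : 0 < a := hb.trans_le hab
  rintro ⟨θ, l⟩ ⟨hθ, hs, hl, -⟩ ⟨θ', l'⟩ ⟨hθ', hs', hl', -⟩ h
  simp only at hθ hs hl hθ' hs' hl'
  have hE : ∀ t, (a * Real.cos t, b * Real.sin t).1 ^ 2 / a ^ 2 +
      (a * Real.cos t, b * Real.sin t).2 ^ 2 / b ^ 2 = 1 := by
    intro t
    simp only
    field_simp
    exact Real.cos_sq_add_sin_sq t
  have h11 := sq_dist_ellipseNormalPoint ha hb (θ, l) (hE θ)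
  have h12 := sq_dist_ellipseNormalPoint ha hb (θ, l) (hE θ')
  have h21 := sq_dist_ellipseNormalPoint ha hb (θ', l') (hE θ)
  have h22 := sq_dist_ellipseNormalPoint ha hb (θ', l') (hE θ')
  rw [← h] at h21 h22
  simp only at h11 h12 h21 h22
  have hpos : ∀ l : ℝ, -b ^ 2 < l → 0 < 1 + l / a ^ 2 ∧ 0 < 1 + l / b ^ 2 := by
    intro l hl
    constructor
    · rw [← div_self (pow_pos ha 2).ne', ← add_div]
      exact div_pos (by nlinarith) (by positivity)
    · rw [← div_self (pow_pos hb 2).ne', ← add_div]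
      exact div_pos (by nlinarith) (by positivity)
  obtain ⟨hA, hB⟩ := hpos l hl
  obtain ⟨hA', hB'⟩ := hpos l' hl'
  have e1 := mul_nonneg hA.le (sq_nonneg (a * Real.cos θ' - a * Real.cos θ))
  have e2 := mul_nonneg hB.le (sq_nonneg (b * Real.sin θ' - b * Real.sin θ))
  have e3 := mul_nonneg hA'.le (sq_nonneg (a * Real.cos θ - a * Real.cos θ'))
  have e4 := mul_nonneg hB'.le (sq_nonneg (b * Real.sin θ - b * Real.sin θ'))
  have z1 : (1 + l / a ^ 2) * (a * Real.cos θ' - a * Real.cos θ) ^ 2 = 0 := by linarith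
  have z2 : (1 + l / b ^ 2) * (b * Real.sin θ' - b * Real.sin θ) ^ 2 = 0 := by linarith
  have hc : Real.cos θ = Real.cos θ' := by
    have := pow_eq_zero_iff two_ne_zero |>.1 ((mul_eq_zero.1 z1).resolve_left hA.ne')
    exact (mul_left_cancel₀ ha.ne' (sub_eq_zero.1 this)).symm
  have hs : Real.sin θ = Real.sin θ' := by
    have := pow_eq_zero_iff two_ne_zero |>.1 ((mul_eq_zero.1 z2).resolve_left hB.ne')
    exact (mul_left_cancel₀ hb.ne' (sub_eq_zero.1 this)).symm
  obtain rfl : θ = θ' := eq_of_cos_eq_sin_eq hθ hθ' hc hs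
  have h2 : Real.sin θ * (b + l / b) = Real.sin θ * (b + l' / b) := congrArg Prod.snd h
  have h3 := mul_left_cancel₀ hs' h2
  have h4 : l = l' := by
    field_simp at h3
    linarith
  rw [h4]

/-- Every point off the major axis lies on a normal of the ellipse, on the same side of the major
axis as its foot. -/
theorem exists_ellipseNormalPoint_eq {a b : ℝ} (hb : 0 < b) (hab : b ≤ a) {x : ℝ × ℝ}
    (hx : x.2 ≠ 0) :
    ∃ q : ℝ × ℝ, q.1 ∈ Ioc (-π) π ∧ Real.sin q.1 ≠ 0 ∧ -b ^ 2 < q.2 ∧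
      ellipseNormalPoint a b q = x := by
  have ha : 0 < a := hb.trans_le hab
  have hx2 : 0 < |x.2| := abs_pos.2 hx
  have hx1 : 0 ≤ |x.1| := abs_nonneg _
  have hbx : 0 < b * |x.2| := mul_pos hb hx2
  have hax : 0 ≤ a * |x.1| := mul_nonneg ha.le hx1
  have hb2 : b ^ 2 ≤ a ^ 2 := pow_le_pow_left₀ hb.le hab 2
  have hb2' : 0 < b ^ 2 := pow_pos hb 2
  have hcont : ContinuousOn (fun l : ℝ ↦ (a * x.1 / (a ^ 2 + l)) ^ 2 + (b * x.2 / (b ^ 2 + l)) ^ 2)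
      (Icc (-b ^ 2 + b * |x.2|) (2 * (a * |x.1| + b * |x.2|))) := by
    apply ContinuousOn.add
    · refine (ContinuousOn.div (by fun_prop) (by fun_prop) fun l hl ↦ ?_).pow 2
      have := hl.1
      exact ne_of_gt (by linarith)
    · refine (ContinuousOn.div (by fun_prop) (by fun_prop) fun l hl ↦ ?_).pow 2
      have := hl.1
      exact ne_of_gt (by linarith)
  have hmem : (1 : ℝ) ∈ Icc
      ((a * x.1 / (a ^ 2 + 2 * (a * |x.1| + b * |x.2|))) ^ 2 +
        (b * x.2 / (b ^ 2 + 2 * (a * |x.1| + b * |x.2|))) ^ 2)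
      ((a * x.1 / (a ^ 2 + (-b ^ 2 + b * |x.2|))) ^ 2 +
        (b * x.2 / (b ^ 2 + (-b ^ 2 + b * |x.2|))) ^ 2) := by
    constructor
    · have key : ∀ c y D : ℝ, 0 < c → 0 < D → 2 * (c * |y|) ≤ D → (c * y / D) ^ 2 ≤ 1 / 4 := by
        intro c y D hc hD h
        rw [← sq_abs, abs_div, abs_mul, abs_of_pos hc, abs_of_pos hD]
        have h1 : c * |y| / D ≤ 1 / 2 := by
          rw [div_le_iff₀ hD]
          linarith
        have h0 : 0 ≤ c * |y| / D := by positivity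
        nlinarith
      have k1 := key a x.1 (a ^ 2 + 2 * (a * |x.1| + b * |x.2|)) ha (by linarith) (by linarith)
      have k2 := key b x.2 (b ^ 2 + 2 * (a * |x.1| + b * |x.2|)) hb (by linarith) (by linarith)
      linarith
    · have h1 : (b * x.2 / (b ^ 2 + (-b ^ 2 + b * |x.2|))) ^ 2 = 1 := by
        rw [add_neg_cancel_left, div_pow, mul_pow, mul_pow, sq_abs, div_self]
        positivity
      rw [h1]
      linarith [sq_nonneg (a * x.1 / (a ^ 2 + (-b ^ 2 + b * |x.2|)))]
  obtain ⟨l, hl, hl1⟩ := intermediate_value_Icc' (by linarith) hcont hmem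
  have hlb : -b ^ 2 < l := by linarith [hl.1]
  have hA : a ^ 2 + l ≠ 0 := ne_of_gt (by linarith)
  have hB : b ^ 2 + l ≠ 0 := ne_of_gt (by linarith)
  obtain ⟨θ, hθ, hc, hs⟩ := exists_mem_Ioc_cos_sin hl1
  refine ⟨(θ, l), hθ, ?_, hlb, ?_⟩
  · rw [hs]
    exact div_ne_zero (mul_ne_zero hb.ne' hx) hB
  · simp only [ellipseNormalPoint, hc, hs]
    ext
    · simp only
      field_simp
    · simp only
      field_simp

theorem image_ellipseNormalPoint {a b r : ℝ} (hb : 0 < b) (hab : b ≤ a) (hr1 : b ≤ r)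
    (hr2 : r ≤ a) :
    ellipseNormalPoint a b '' ellipseNearParams a b r =
      {x | x.2 ≠ 0 ∧ (ellipseInterCircle a b r x).Nonempty} := by
  have ha : 0 < a := hb.trans_le hab
  have hr : 0 < r := hb.trans_le hr1
  have hpos : ∀ c l : ℝ, 0 < c → b ≤ c → -b ^ 2 < l → 0 ≤ 1 + l / c ^ 2 := by
    intro c l hc hbc hl
    rw [← div_self (pow_pos hc 2).ne', ← add_div]
    exact div_nonneg (by nlinarith) (by positivity)
  ext x
  constructor
  · rintro ⟨⟨θ, l⟩, ⟨hθ, hs, hl, hlr⟩, rfl⟩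
    simp only at hθ hs hl hlr
    constructor
    · have : b + l / b ≠ 0 := by
        have : b + l / b = (b ^ 2 + l) / b := by field_simp
        rw [this]
        exact (div_pos (by linarith) hb).ne'
      exact mul_ne_zero hs this
    · set x := ellipseNormalPoint a b (θ, l) with hx
      set h : ℝ → ℝ := fun t ↦ (a * Real.cos t - x.1) ^ 2 + (b * Real.sin t - x.2) ^ 2 with hh
      have hE : ∀ t, (a * Real.cos t, b * Real.sin t).1 ^ 2 / a ^ 2 +
          (a * Real.cos t, b * Real.sin t).2 ^ 2 / b ^ 2 = 1 := by
        intro t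
        simp only
        field_simp
        exact Real.cos_sq_add_sin_sq t
      have hnear : h θ ≤ r ^ 2 := by
        have h1 := sq_dist_ellipseNormalPoint ha hb (θ, l) (hE θ)
        simp only [sub_self] at h1
        simp only [hh, hx]
        rw [h1]
        have hw := ellipseSpeed_le hb hab θ
        have hw' := le_ellipseSpeed hb hab θ
        have hb2 := mul_le_mul_of_nonneg_left hr1 (mul_nonneg ha.le hb.le)
        have h2 : -(r * a * b) ≤ l * ellipseSpeed a b θ := by nlinarith
        have h3 : |l * ellipseSpeed a b θ / (a * b)| ≤ r := by
          rw [abs_div, abs_of_pos (mul_pos ha hb), div_le_iff₀ (mul_pos ha hb)]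
          exact abs_le.2 ⟨by linarith, by linarith⟩
        have h4 := sq_le_sq' (abs_le.1 h3).1 (abs_le.1 h3).2
        linarith
      have hfar : ∃ t, r ^ 2 ≤ h t := by
        rcases le_total 0 x.1 with h0 | h0
        · refine ⟨π, ?_⟩
          simp only [hh, Real.cos_pi, Real.sin_pi]
          nlinarith [sq_nonneg x.2]
        · refine ⟨0, ?_⟩
          simp only [hh, Real.cos_zero, Real.sin_zero]
          nlinarith [sq_nonneg x.2]
      obtain ⟨t, ht⟩ := hfar
      obtain ⟨s, hs⟩ := intermediate_value_univ θ t (by fun_prop : Continuous h) ⟨hnear, ht⟩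
      exact ⟨(a * Real.cos s, b * Real.sin s), hE s, hs⟩
  · rintro ⟨hx, p, hp1, hp2⟩
    obtain ⟨q, hq1, hq2, hq3, rfl⟩ := exists_ellipseNormalPoint_eq hb hab hx
    refine ⟨q, ⟨hq1, hq2, hq3, ?_⟩, rfl⟩
    have h1 := sq_dist_ellipseNormalPoint ha hb q hp1
    rw [hp2] at h1
    have e1 := mul_nonneg (hpos a q.2 ha hab hq3) (sq_nonneg (p.1 - a * Real.cos q.1))
    have e2 := mul_nonneg (hpos b q.2 hb le_rfl hq3) (sq_nonneg (p.2 - b * Real.sin q.1))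
    have h2 : q.2 * ellipseSpeed a b q.1 / (a * b) ≤ r := (le_abs_self _).trans (abs_le_of_sq_le_sq (by linarith) hr.le)
    rw [div_le_iff₀ (mul_pos ha hb)] at h2
    linarith

theorem integral_abs_cos : ∫ t in (-π)..π, |Real.cos t| = 4 := by
  have hper : Function.Periodic (fun t ↦ |Real.cos t|) (2 * π) := fun t ↦ by simp
  have h1 := hper.intervalIntegral_add_eq (-π) (-(π / 2))
  rw [show -π + 2 * π = π by ring, show -(π / 2) + 2 * π = π + π / 2 by ring] at h1
  have hcd : ∀ c d : ℝ, IntervalIntegrable (fun t ↦ |Real.cos t|) volume c d := fun c d ↦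
    (by fun_prop : Continuous fun t ↦ |Real.cos t|).intervalIntegrable c d
  have h2 : ∫ t in (-(π / 2))..(π / 2), |Real.cos t| = 2 := by
    rw [intervalIntegral.integral_congr (g := Real.cos)]
    · rw [integral_cos, Real.sin_neg, Real.sin_pi_div_two]
      norm_num
    · intro t ht
      rw [uIcc_of_le (by linarith [Real.pi_pos])] at ht
      exact abs_of_nonneg (Real.cos_nonneg_of_mem_Icc ht)
  have h3 : ∫ t in (π / 2)..(π + π / 2), |Real.cos t| = 2 := by
    rw [intervalIntegral.integral_congr (g := fun t ↦ -Real.cos t)]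
    · rw [intervalIntegral.integral_neg, integral_cos, add_comm π, Real.sin_add_pi,
        Real.sin_pi_div_two]
      norm_num
    · intro t ht
      rw [uIcc_of_le (by linarith [Real.pi_pos])] at ht
      exact abs_of_nonpos (Real.cos_nonpos_of_pi_div_two_le_of_le ht.1 ht.2)
  rw [h1, ← intervalIntegral.integral_add_adjacent_intervals (hcd _ (π / 2)) (hcd _ _), h2, h3]
  norm_num

theorem integral_abs_mul_cos_add_mul_sin (A B : ℝ) :
    ∫ t in (-π)..π, |A * Real.cos t + B * Real.sin t| = 4 * √(A ^ 2 + B ^ 2) := by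
  rcases (add_nonneg (sq_nonneg A) (sq_nonneg B)).eq_or_lt with h | h
  · obtain rfl : A = 0 := by nlinarith [sq_nonneg A, sq_nonneg B]
    obtain rfl : B = 0 := by nlinarith [sq_nonneg B]
    simp
  · set R := √(A ^ 2 + B ^ 2) with hR
    have hR0 : 0 < R := Real.sqrt_pos.2 h
    have hR2 : R ^ 2 = A ^ 2 + B ^ 2 := Real.sq_sqrt h.le
    obtain ⟨α, -, hc, hs⟩ := exists_mem_Ioc_cos_sin (c := A / R) (s := B / R)
      (by field_simp; exact hR2.symm)
    have h1 : ∀ t, |A * Real.cos t + B * Real.sin t| = R * |Real.cos (t - α)| := by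
      intro t
      have h3 : A * Real.cos t + B * Real.sin t = R * Real.cos (t - α) := by
        rw [Real.cos_sub, hc, hs]
        field_simp
      rw [h3, abs_mul, abs_of_pos hR0]
    simp_rw [h1]
    have hper : Function.Periodic (fun t ↦ |Real.cos t|) (2 * π) := fun t ↦ by simp
    have h2 := hper.intervalIntegral_add_eq (-π) (-π - α)
    rw [show -π + 2 * π = π by ring, show -π - α + 2 * π = π - α by ring, integral_abs_cos] at h2
    rw [intervalIntegral.integral_const_mul,
      intervalIntegral.integral_comp_sub_right (fun t ↦ |Real.cos t|), ← h2]
    ring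

theorem integral_ellipseSpeed {a b : ℝ} (hb : 0 < b) (hab : b ≤ a) :
    ∫ θ in (-π)..π, ellipseSpeed a b θ = 4 * a * Ecomp (ecc a b) := by
  have ha : 0 < a := hb.trans_le hab
  have hba : b ^ 2 ≤ a ^ 2 := pow_le_pow_left₀ hb.le hab 2
  set P : ℝ → ℝ := fun θ ↦ √(1 - ecc a b ^ 2 * Real.sin θ ^ 2) with hP
  have hPc : Continuous P := by fun_prop
  have hcd : ∀ c d : ℝ, IntervalIntegrable P volume c d := fun c d ↦ hPc.intervalIntegrable c d
  have hw : ∀ θ, ellipseSpeed a b θ = a * P (θ + π / 2) := by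
    intro θ
    have h1 : b ^ 2 * Real.cos θ ^ 2 + a ^ 2 * Real.sin θ ^ 2 =
        a ^ 2 * (1 - ecc a b ^ 2 * Real.cos θ ^ 2) := by
      rw [ecc, div_pow, Real.sq_sqrt (sub_nonneg.2 hba)]
      field_simp
      linear_combination a ^ 2 * Real.cos_sq_add_sin_sq θ
    simp only [hP, ellipseSpeed, Real.sin_add_pi_div_two]
    rw [h1, Real.sqrt_mul (sq_nonneg a), Real.sqrt_sq ha.le]
  have hE : Ecomp (ecc a b) = ∫ θ in (0)..(π / 2), P θ := rfl
  have hneg : ∫ θ in (-(π / 2))..0, P θ = ∫ θ in (0)..(π / 2), P θ := by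
    have := intervalIntegral.integral_comp_neg (a := 0) (b := π / 2) P
    rw [neg_zero] at this
    rw [← this]
    simp [hP]
  have hhalf : ∫ θ in (-(π / 2))..(π / 2), P θ = 2 * Ecomp (ecc a b) := by
    rw [← intervalIntegral.integral_add_adjacent_intervals (hcd _ 0) (hcd _ _), hneg, hE]
    ring
  have hshift : ∫ θ in (π / 2)..(π + π / 2), P θ = 2 * Ecomp (ecc a b) := by
    have h1 := intervalIntegral.integral_comp_add_right (a := -(π / 2)) (b := π / 2) P π
    rw [show -(π / 2) + π = π / 2 by ring, show π / 2 + π = π + π / 2 by ring] at h1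
    rw [← h1, ← hhalf]
    simp [hP]
  simp_rw [hw]
  rw [intervalIntegral.integral_const_mul, intervalIntegral.integral_comp_add_right P,
    show -π + π / 2 = -(π / 2) by ring,
    ← intervalIntegral.integral_add_adjacent_intervals (hcd _ (π / 2)) (hcd _ _), hhalf, hshift]
  ring

theorem integral_ellipseSpeed_sq (a b : ℝ) :
    ∫ θ in (-π)..π, ellipseSpeed a b θ ^ 2 = π * (a ^ 2 + b ^ 2) := by
  simp_rw [ellipseSpeed_sq]
  rw [intervalIntegral.integral_add (Continuous.intervalIntegrable (by fun_prop) _ _)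
    (Continuous.intervalIntegrable (by fun_prop) _ _), intervalIntegral.integral_const_mul,
    intervalIntegral.integral_const_mul, integral_cos_sq, integral_sin_sq]
  simp
  ring

theorem integral_inv_ellipseSpeed_sq {a b : ℝ} (ha : 0 < a) (hb : 0 < b) :
    ∫ θ in (-π)..π, a * b / ellipseSpeed a b θ ^ 2 = 2 * π := by
  have hd : ∀ θ, 0 < b * Real.cos θ ^ 2 + a * Real.sin θ ^ 2 := by
    intro θ
    rcases eq_or_ne (Real.cos θ) 0 with h | h
    · have : Real.sin θ ^ 2 = 1 := by simpa [h] using Real.cos_sq_add_sin_sq θ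
      rw [h, this]
      simpa using ha
    · positivity
  have hw : ∀ θ, 0 < ellipseSpeed a b θ ^ 2 := by
    intro θ
    rw [ellipseSpeed_sq]
    rcases eq_or_ne (Real.cos θ) 0 with h | h
    · have : Real.sin θ ^ 2 = 1 := by simpa [h] using Real.cos_sq_add_sin_sq θ
      rw [h, this]
      positivity
    · positivity
  have hder : ∀ θ ∈ uIcc (-π) π, HasDerivAt (fun θ ↦ θ + Real.arctan ((a - b) *
      (Real.sin θ * Real.cos θ) / (b * Real.cos θ ^ 2 + a * Real.sin θ ^ 2)))
      (a * b / ellipseSpeed a b θ ^ 2) θ := by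
    intro θ _
    have hs := Real.hasDerivAt_sin θ
    have hc := Real.hasDerivAt_cos θ
    have hN : HasDerivAt (fun t ↦ (a - b) * (Real.sin t * Real.cos t))
        ((a - b) * (Real.cos θ ^ 2 - Real.sin θ ^ 2)) θ := by
      convert! (hs.mul hc).const_mul (a - b) using 1
      ring
    have hD : HasDerivAt (fun t ↦ b * Real.cos t ^ 2 + a * Real.sin t ^ 2)
        (2 * (a - b) * (Real.sin θ * Real.cos θ)) θ := by
      convert! ((hc.pow 2).const_mul b).add ((hs.pow 2).const_mul a) using 1
      simp
      ring
    convert! (hasDerivAt_id' θ).add (hN.div hD (hd θ).ne').arctan using 1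
    have hd0 := (hd θ).ne'
    have hw0 := (hw θ).ne'
    rw [ellipseSpeed_sq] at hw0 ⊢
    have hcs := Real.cos_sq_add_sin_sq θ
    simp only [Pi.div_apply]
    have h2 : 1 + ((a - b) * (Real.sin θ * Real.cos θ) /
        (b * Real.cos θ ^ 2 + a * Real.sin θ ^ 2)) ^ 2 =
        (b ^ 2 * Real.cos θ ^ 2 + a ^ 2 * Real.sin θ ^ 2) /
          (b * Real.cos θ ^ 2 + a * Real.sin θ ^ 2) ^ 2 := by
      field_simp
      linear_combination (b ^ 2 * Real.cos θ ^ 2 + a ^ 2 * Real.sin θ ^ 2) * hcs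
    have h3 : (a - b) * (Real.cos θ ^ 2 - Real.sin θ ^ 2) *
        (b * Real.cos θ ^ 2 + a * Real.sin θ ^ 2) - (a - b) * (Real.sin θ * Real.cos θ) *
        (2 * (a - b) * (Real.sin θ * Real.cos θ)) =
        a * b - (b ^ 2 * Real.cos θ ^ 2 + a ^ 2 * Real.sin θ ^ 2) := by
      linear_combination ((a - b) * (b * Real.cos θ ^ 2 - a * Real.sin θ ^ 2) + a * b) * hcs
    rw [h2, h3]
    field_simp
    ring
  rw [intervalIntegral.integral_eq_sub_of_hasDerivAt hder]
  · simp
    ring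
  · apply Continuous.intervalIntegrable
    exact continuous_const.div ((continuous_ellipseSpeed a b).pow 2) fun θ ↦ (hw θ).ne'

theorem setLIntegral_Ioc_ofReal {f : ℝ → ℝ} {c d : ℝ} (hcd : c ≤ d) (hf : Continuous f)
    (h0 : ∀ t ∈ Ioc c d, 0 ≤ f t) :
    ∫⁻ t in Ioc c d, ENNReal.ofReal (f t) = ENNReal.ofReal (∫ t in c..d, f t) := by
  rw [intervalIntegral.integral_of_le hcd, ofReal_integral_eq_lintegral_ofReal]
  · exact (hf.intervalIntegrable c d).1
  · exact (ae_restrict_iff' measurableSet_Ioc).2 (ae_of_all _ h0)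

theorem lintegral_jacobian_ellipseAddCircle {a b r : ℝ} (hb : 0 < b) (hab : b ≤ a) (hr : 0 < r) :
    ∫⁻ q in Ioc (-π) π ×ˢ Ioc (-π) π, ENNReal.ofReal
        (r * |-a * Real.sin q.1 * Real.cos q.2 + b * Real.cos q.1 * Real.sin q.2|) =
      ENNReal.ofReal (16 * r * a * Ecomp (ecc a b)) := by
  have hpi : -π ≤ π := by linarith [Real.pi_pos]
  rw [Measure.volume_eq_prod, ← Measure.prod_restrict, lintegral_prod _ (by fun_prop)]
  have h1 : ∀ θ, ∫⁻ φ in Ioc (-π) π, ENNReal.ofReal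
      (r * |-a * Real.sin θ * Real.cos φ + b * Real.cos θ * Real.sin φ|) =
      ENNReal.ofReal (r * (4 * ellipseSpeed a b θ)) := by
    intro θ
    rw [setLIntegral_Ioc_ofReal hpi (by fun_prop) fun φ _ ↦ by positivity,
      intervalIntegral.integral_const_mul, integral_abs_mul_cos_add_mul_sin, ellipseSpeed]
    congr 4
    ring
  simp_rw [h1]
  have hc := continuous_ellipseSpeed a b
  rw [setLIntegral_Ioc_ofReal hpi (by fun_prop) fun θ _ ↦ by unfold ellipseSpeed; positivity,
    intervalIntegral.integral_const_mul, intervalIntegral.integral_const_mul,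
    integral_ellipseSpeed hb hab]
  congr 1
  ring

theorem measurableSet_ellipseNearParams (a b r : ℝ) :
    MeasurableSet (ellipseNearParams a b r) := by
  have hw := (continuous_ellipseSpeed a b).measurable
  refine (measurableSet_Ioc.preimage measurable_fst).inter ?_
  refine ((measurableSet_singleton 0).preimage
    (Real.measurable_sin.comp measurable_fst)).compl.inter ?_
  exact (measurableSet_lt measurable_const measurable_snd).inter
    (measurableSet_le (measurable_snd.mul (hw.comp measurable_fst)) measurable_const)

theorem lintegral_jacobian_ellipseNormalPoint {a b r : ℝ} (hb : 0 < b) (hab : b ≤ a)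
    (hr : 0 < r) :
    ∫⁻ q in ellipseNearParams a b r,
        ENNReal.ofReal ((ellipseSpeed a b q.1 ^ 2 + q.2) / (a * b)) =
      ENNReal.ofReal (4 * r * a * Ecomp (ecc a b) + π * r ^ 2 + π * a * b) := by
  have ha : 0 < a := hb.trans_le hab
  have hpi : -π ≤ π := by linarith [Real.pi_pos]
  have hwc := continuous_ellipseSpeed a b
  have hw0 : ∀ θ, 0 < ellipseSpeed a b θ := fun θ ↦ hb.trans_le (le_ellipseSpeed hb hab θ)
  have hF : Measurable fun q : ℝ × ℝ ↦
      ENNReal.ofReal ((ellipseSpeed a b q.1 ^ 2 + q.2) / (a * b)) := by fun_prop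
  have hinner : ∀ θ, ∫⁻ l in Ioc (-b ^ 2) (r * a * b / ellipseSpeed a b θ),
      ENNReal.ofReal ((ellipseSpeed a b θ ^ 2 + l) / (a * b)) =
      ENNReal.ofReal (r * ellipseSpeed a b θ + r ^ 2 / 2 * (a * b / ellipseSpeed a b θ ^ 2) +
        b / a * ellipseSpeed a b θ ^ 2 - b ^ 3 / (2 * a)) := by
    intro θ
    have hw := hw0 θ
    have hle : -b ^ 2 ≤ r * a * b / ellipseSpeed a b θ :=
      (neg_nonpos.2 (sq_nonneg b)).trans (by positivity)
    rw [setLIntegral_Ioc_ofReal hle (by fun_prop)]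
    · congr 1
      rw [intervalIntegral.integral_eq_sub_of_hasDerivAt
        (f := fun l ↦ (ellipseSpeed a b θ ^ 2 * l + l ^ 2 / 2) / (a * b))]
      · field_simp
        ring
      · intro l _
        convert! (((hasDerivAt_id' l).const_mul (ellipseSpeed a b θ ^ 2)).add
          (((hasDerivAt_id' l).pow 2).div_const 2)).div_const (a * b) using 1
        simp
      · exact Continuous.intervalIntegrable (by fun_prop) _ _
    · intro l hl
      have h1 := pow_le_pow_left₀ hb.le (le_ellipseSpeed hb hab θ) 2
      exact div_nonneg (by linarith [hl.1]) (mul_pos ha hb).le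
  have hsin : ∀ᵐ θ ∂(volume.restrict (Ioc (-π) π)), Real.sin θ ≠ 0 := by
    rw [ae_restrict_iff' measurableSet_Ioc]
    have h1 : volume ({0, π} : Set ℝ) = 0 := (Set.toFinite _).measure_zero volume
    filter_upwards [compl_mem_ae_iff.2 h1] with θ hθ hθI h0
    apply hθ
    rcases eq_or_ne θ π with h | h
    · exact Or.inr h
    · exact Or.inl ((Real.sin_eq_zero_iff_of_lt_of_lt hθI.1 (lt_of_le_of_ne hθI.2 h)).1 h0)
  have hslice : ∀ θ, Real.sin θ ≠ 0 → θ ∈ Ioc (-π) π →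
      ∀ l, (θ, l) ∈ ellipseNearParams a b r ↔
        l ∈ Ioc (-b ^ 2) (r * a * b / ellipseSpeed a b θ) := by
    intro θ hs hθ l
    rw [mem_Ioc, le_div_iff₀ (hw0 θ)]
    exact ⟨fun h ↦ h.2.2, fun h ↦ ⟨hθ, hs, h⟩⟩
  have hD := measurableSet_ellipseNearParams a b r
  rw [← lintegral_indicator hD, Measure.volume_eq_prod,
    lintegral_prod _ (hF.indicator hD).aemeasurable]
  have houter : ∫⁻ θ, ∫⁻ l, (ellipseNearParams a b r).indicator (fun q : ℝ × ℝ ↦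
      ENNReal.ofReal ((ellipseSpeed a b q.1 ^ 2 + q.2) / (a * b))) (θ, l) =
      ∫⁻ θ in Ioc (-π) π, ENNReal.ofReal (r * ellipseSpeed a b θ +
        r ^ 2 / 2 * (a * b / ellipseSpeed a b θ ^ 2) + b / a * ellipseSpeed a b θ ^ 2 -
          b ^ 3 / (2 * a)) := by
    rw [← lintegral_indicator measurableSet_Ioc]
    refine lintegral_congr_ae ?_
    filter_upwards [(ae_restrict_iff' measurableSet_Ioc).1 hsin] with θ hs
    by_cases hθ : θ ∈ Ioc (-π) π
    · rw [indicator_of_mem hθ, ← hinner θ, ← lintegral_indicator measurableSet_Ioc]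
      congr 1
      ext l
      simp only [indicator, hslice θ (hs hθ) hθ]
    · rw [indicator_of_notMem hθ]
      have : ∀ l, (θ, l) ∉ ellipseNearParams a b r := fun l h ↦ hθ h.1
      simp [indicator, this]
  have hinv : Continuous fun θ ↦ a * b / ellipseSpeed a b θ ^ 2 :=
    continuous_const.div (hwc.pow 2) fun θ ↦ (pow_pos (hw0 θ) 2).ne'
  rw [houter, setLIntegral_Ioc_ofReal hpi (by fun_prop)]
  · congr 1
    have hi : ∀ {f : ℝ → ℝ}, Continuous f → IntervalIntegrable f volume (-π) π := fun hf ↦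
      hf.intervalIntegrable _ _
    rw [intervalIntegral.integral_sub (hi (by fun_prop)) (hi (by fun_prop)),
      intervalIntegral.integral_add (hi (by fun_prop)) (hi (by fun_prop)),
      intervalIntegral.integral_add (hi (by fun_prop)) (hi (by fun_prop)),
      intervalIntegral.integral_const_mul, intervalIntegral.integral_const_mul,
      intervalIntegral.integral_const_mul, intervalIntegral.integral_const,
      integral_ellipseSpeed hb hab, integral_inv_ellipseSpeed_sq ha hb, integral_ellipseSpeed_sq]
    simp only [smul_eq_mul]
    field_simp
    ring
  · intro θ _
    have h1 := pow_le_pow_left₀ hb.le (le_ellipseSpeed hb hab θ) 2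
    have h2 : b ^ 3 / (2 * a) ≤ b / a * ellipseSpeed a b θ ^ 2 := by
      have h3 : b ^ 3 / (2 * a) = b / a * (b ^ 2 / 2) := by field_simp
      rw [h3]
      exact mul_le_mul_of_nonneg_left (by nlinarith [sq_nonneg b]) (by positivity)
    have h4 := (hw0 θ).le
    have h5 : 0 ≤ r * ellipseSpeed a b θ + r ^ 2 / 2 * (a * b / ellipseSpeed a b θ ^ 2) := by
      positivity
    linarith

/-- The area of the set of centres of the circles of radius `r` that meet the ellipse. -/
theorem volume_nonempty_ellipseInterCircle {a b r : ℝ} (hb : 0 < b) (hab : b ≤ a) (hr1 : b ≤ r)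
    (hr2 : r ≤ a) :
    volume {x | (ellipseInterCircle a b r x).Nonempty} =
      ENNReal.ofReal (4 * r * a * Ecomp (ecc a b) + π * r ^ 2 + π * a * b) := by
  have ha : 0 < a := hb.trans_le hab
  have hnull : volume (univ ×ˢ {0} : Set (ℝ × ℝ)) = 0 := by
    rw [Measure.volume_eq_prod, Measure.prod_prod]
    simp
  have hae : {x | (ellipseInterCircle a b r x).Nonempty} =ᵐ[volume]
      {x : ℝ × ℝ | x.2 ≠ 0 ∧ (ellipseInterCircle a b r x).Nonempty} := by
    filter_upwards [compl_mem_ae_iff.2 hnull] with x hx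
    have h2 : x.2 ≠ 0 := fun h ↦ hx ⟨mem_univ _, h⟩
    exact propext ⟨fun h ↦ ⟨h2, h⟩, fun h ↦ h.2⟩
  rw [measure_congr hae, ← image_ellipseNormalPoint hb hab hr1 hr2,
    ← lintegral_abs_det_fderiv_eq_addHaar_image volume (measurableSet_ellipseNearParams a b r)
      (fun q _ ↦ (hasFDerivAt_ellipseNormalPoint a b q).hasFDerivWithinAt)
      (injOn_ellipseNormalPoint hb hab),
    ← lintegral_jacobian_ellipseNormalPoint hb hab (hb.trans_le hr1)]
  refine setLIntegral_congr_fun (measurableSet_ellipseNearParams a b r) fun q hq ↦ ?_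
  have h1 := pow_le_pow_left₀ hb.le (le_ellipseSpeed hb hab q.1) 2
  have h0 : 0 ≤ (ellipseSpeed a b q.1 ^ 2 + q.2) / (a * b) :=
    div_nonneg (by linarith [hq.2.2.1]) (mul_pos ha hb).le
  have hd : (planeLin (-Real.sin q.1 * (a + q.2 / a)) (Real.cos q.1 * a⁻¹)
      (Real.cos q.1 * (b + q.2 / b)) (Real.sin q.1 * b⁻¹)).det =
      -((ellipseSpeed a b q.1 ^ 2 + q.2) / (a * b)) := by
    rw [det_planeLin, ellipseSpeed_sq]
    field_simp
    linear_combination (-q.2) * Real.cos_sq_add_sin_sq q.1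
  rw [hd, abs_neg, abs_of_nonneg h0]

theorem volume_encard_ellipseInterCircle_eq_four {a b r : ℝ} (hb : 0 < b) (hab : b ≤ a)
    (hr1 : b ≤ r) (hr2 : r ≤ a) :
    volume {x | (ellipseInterCircle a b r x).encard = 4} =
      ENNReal.ofReal (4 * r * a * Ecomp (ecc a b) - π * r ^ 2 - π * a * b) := by
  have ha : 0 < a := hb.trans_le hab
  have hr : 0 < r := hb.trans_le hr1
  obtain ⟨g, hgm, hga, hgi⟩ := exists_measurable_ae_eq_encard_ellipseInterCircle ha hb hr
  rw [lintegral_jacobian_ellipseAddCircle hb hab hr] at hgi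
  have hN : {x | (ellipseInterCircle a b r x).Nonempty} =ᵐ[volume] {x | g x ≠ 0} := by
    filter_upwards [hga] with x hx
    refine propext (Iff.trans ?_ (not_congr (Eq.congr_left hx.1)).symm)
    change (ellipseInterCircle a b r x).Nonempty ↔ _
    rw [ENat.toENNReal_eq_zero, encard_eq_zero, nonempty_iff_ne_empty]
  have hA : {x | (ellipseInterCircle a b r x).encard = 4} =ᵐ[volume] {x | g x = 4} := by
    filter_upwards [hga] with x hx
    refine propext (Iff.trans ?_ (Eq.congr_left hx.1).symm)
    change (ellipseInterCircle a b r x).encard = 4 ↔ _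
    rw [← ENat.toENNReal_inj]
    simp
  have hNm : MeasurableSet {x | g x ≠ 0} := (hgm (measurableSet_singleton 0)).compl
  have hAm : MeasurableSet {x | g x = 4} := hgm (measurableSet_singleton 4)
  have hg2 : g =ᵐ[volume] fun x ↦ {x | g x ≠ 0}.indicator (fun _ ↦ 2) x +
      {x | g x = 4}.indicator (fun _ ↦ 2) x := by
    filter_upwards [hga] with x hx
    obtain ⟨hx1, hx2⟩ := hx
    rcases hx2 with h | h | h <;> (rw [h] at hx1; simp [indicator, hx1]; try norm_num)
  rw [lintegral_congr_ae hg2, lintegral_add_left (measurable_const.indicator hNm),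
    lintegral_indicator_const hNm, lintegral_indicator_const hAm, ← measure_congr hN,
    ← measure_congr hA, volume_nonempty_ellipseInterCircle hb hab hr1 hr2] at hgi
  set V := volume {x | (ellipseInterCircle a b r x).encard = 4}
  have hE : 0 ≤ Ecomp (ecc a b) :=
    intervalIntegral.integral_nonneg (by positivity) fun θ _ ↦ Real.sqrt_nonneg _
  have h2 : (2 : ENNReal) = ENNReal.ofReal 2 := by simp
  have hV : V ≠ ⊤ := by
    rintro h
    rw [h] at hgi
    simp at hgi
  have hgi' := congrArg ENNReal.toReal hgi
  rw [ENNReal.toReal_add (by finiteness) (by finiteness), ENNReal.toReal_mul, ENNReal.toReal_mul,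
    ENNReal.toReal_ofReal (by positivity), ENNReal.toReal_ofReal (by positivity)] at hgi'
  rw [← ENNReal.ofReal_toReal hV]
  congr 1
  simp only [ENNReal.toReal_ofNat] at hgi'
  linarith

theorem ncard_sphere_inter_Cset {a b r : ℝ} (hr : 0 ≤ r) (x : E2) :
    (sphere x r ∩ Cset a b).ncard = (ellipseInterCircle a b r (x 0, x 1)).ncard := by
  have hinj : Function.Injective fun y : E2 ↦ (y 0, y 1) := by
    intro y z h
    ext i
    fin_cases i
    · exact congrArg Prod.fst h
    · exact congrArg Prod.snd h
  rw [← ncard_image_of_injective _ hinj]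
  congr 1
  have hs : ∀ y : E2, y ∈ sphere x r ↔ (y 0 - x 0) ^ 2 + (y 1 - x 1) ^ 2 = r ^ 2 := by
    intro y
    rw [mem_sphere, EuclideanSpace.dist_eq, Real.sqrt_eq_iff_eq_sq (by positivity) hr]
    simp [Real.dist_eq, sq_abs]
  ext p
  constructor
  · rintro ⟨y, ⟨hy1, hy2⟩, rfl⟩
    exact ⟨hy2, (hs y).1 hy1⟩
  · rintro ⟨h1, h2⟩
    exact ⟨!₂[p.1, p.2], ⟨(hs _).2 h2, h1⟩, rfl⟩


/-- Case 3 of Lemma 1: for `b ≤ r ≤ a`, the area of the set of centers `x` for which the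
circle of radius `r` about `x` meets the ellipse in exactly four points is
`4raE(ε) − πr² − πab`. -/
theorem area_four_intersections_case3 (a b r : ℝ) (hb : 0 < b) (hab : b ≤ a)
    (hr1 : b ≤ r) (hr2 : r ≤ a) :
    volume {x : E2 | (sphere x r ∩ Cset a b).ncard = 4} =
      ENNReal.ofReal (4*r*a*Ecomp (ecc a b) - π*r^2 - π*a*b) := by
  have hr : 0 < r := hb.trans_le hr1
  have hmp : MeasurePreserving ((MeasurableEquiv.toLp 2 (Fin 2 → ℝ)).symm.trans
      (MeasurableEquiv.finTwoArrow (α := ℝ))) volume volume :=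
    (volume_preserving_finTwoArrow ℝ).comp
      (EuclideanSpace.volume_preserving_symm_measurableEquiv_toLp (Fin 2))
  rw [← volume_encard_ellipseInterCircle_eq_four hb hab hr1 hr2,
    ← hmp.measure_preimage_equiv]
  congr 1
  ext x
  change (sphere x r ∩ Cset a b).ncard = 4 ↔
    (ellipseInterCircle a b r (x 0, x 1)).encard = 4
  rw [ncard_sphere_inter_Cset hr.le, ncard_def, ENat.toNat_eq_iff (by norm_num)]
  rfl
end
end

section
/- Let a > b > 0 and a < r < a²/b. Then the area of the set {x ∈ ℝ² : K(a,b) ⊆ closedBall(x,r)} equals F(β), where F(φ) = 2r²φ + 2ab·arctan((b/a)tanφ) − 4ra·E(φ,ε) + raε² sin(2φ)/√(1−ε² sin²φ) and β = arctan( a√(r² − a²) / √(a⁴ − r²b²) ). -/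
open Real MeasureTheory Set Metric

noncomputable section

/-- The antiderivative `F(φ)` from the paper's Lemma 1. -/
def Ffun (a b r φ : ℝ) : ℝ :=
  2*r^2*φ + 2*a*b*Real.arctan ((b/a)*Real.tan φ) - 4*r*a*Einc (ecc a b) φ
    + r*a*(ecc a b)^2 * Real.sin (2*φ) / Real.sqrt (1 - (ecc a b)^2 * Real.sin φ^2)
/-- The angle `β` from Case 4 of the paper's Lemma 1. -/
def betaAng (a b r : ℝ) : ℝ :=
  Real.arctan (a * Real.sqrt (r^2 - a^2) / Real.sqrt (a^4 - r^2*b^2))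

/-- Support function of the ellipse in the direction `(cos φ, sin φ)`. -/
def ellipseSupport (a b φ : ℝ) : ℝ := √(a^2 * cos φ^2 + b^2 * sin φ^2)

/-- Abscissa of the boundary point of the set of centers with normal angle `φ`. -/
def centerX (a b r φ : ℝ) : ℝ := r * cos φ - a^2 * cos φ / ellipseSupport a b φ

/-- Ordinate of the boundary point of the set of centers with normal angle `φ`. -/
def centerY (a b r φ : ℝ) : ℝ := r * sin φ - b^2 * sin φ / ellipseSupport a b φ

lemma sq_ellipseSupport (a b φ : ℝ) :
    ellipseSupport a b φ ^ 2 = a^2 * cos φ^2 + b^2 * sin φ^2 :=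
  Real.sq_sqrt (by positivity)

lemma ellipseSupport_pos {a b : ℝ} (ha : 0 < a) (hb : 0 < b) (φ : ℝ) :
    0 < ellipseSupport a b φ := by
  apply Real.sqrt_pos.2
  by_cases h : cos φ = 0
  · have : sin φ ^ 2 = 1 := by nlinarith [sin_sq_add_cos_sq φ]
    rw [this]; positivity
  · positivity

lemma continuous_ellipseSupport (a b : ℝ) : Continuous (ellipseSupport a b) := by
  unfold ellipseSupport; fun_prop

lemma hasDerivAt_ellipseSupport {a b : ℝ} (ha : 0 < a) (hb : 0 < b) (φ : ℝ) :
    HasDerivAt (ellipseSupport a b)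
      (-(a^2 - b^2) * sin φ * cos φ / ellipseSupport a b φ) φ := by
  have hp := ellipseSupport_pos ha hb φ
  have h1 : HasDerivAt (fun φ => a^2 * cos φ^2 + b^2 * sin φ^2)
      (-2 * (a^2 - b^2) * sin φ * cos φ) φ := by
    refine ((((hasDerivAt_cos φ).pow 2).const_mul (a^2)).add
      (((hasDerivAt_sin φ).pow 2).const_mul (b^2))).congr_deriv ?_
    push_cast; ring
  have hne : a^2 * cos φ^2 + b^2 * sin φ^2 ≠ 0 := by
    rw [← sq_ellipseSupport]; positivity
  refine (h1.sqrt hne).congr_deriv ?_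
  change _ / (2 * ellipseSupport a b φ) = _
  field_simp

lemma hasDerivAt_centerX {a b : ℝ} (ha : 0 < a) (hb : 0 < b) (r φ : ℝ) :
    HasDerivAt (centerX a b r)
      (-sin φ * (r - a^2 * b^2 / ellipseSupport a b φ ^ 3)) φ := by
  have hp := ellipseSupport_pos ha hb φ
  have hsq := sq_ellipseSupport a b φ
  have hsc := sin_sq_add_cos_sq φ
  refine (((hasDerivAt_cos φ).const_mul r).sub
    (((hasDerivAt_cos φ).const_mul (a^2)).div (hasDerivAt_ellipseSupport ha hb φ)
      hp.ne')).congr_deriv ?_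
  field_simp
  rw [hsq]
  linear_combination (sin φ * a^2 * b^2) * hsc

lemma hasDerivAt_centerY {a b : ℝ} (ha : 0 < a) (hb : 0 < b) (r φ : ℝ) :
    HasDerivAt (centerY a b r)
      (cos φ * (r - a^2 * b^2 / ellipseSupport a b φ ^ 3)) φ := by
  have hp := ellipseSupport_pos ha hb φ
  have hsq := sq_ellipseSupport a b φ
  have hsc := sin_sq_add_cos_sq φ
  refine (((hasDerivAt_sin φ).const_mul r).sub
    (((hasDerivAt_sin φ).const_mul (b^2)).div (hasDerivAt_ellipseSupport ha hb φ)
      hp.ne')).congr_deriv ?_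
  field_simp
  rw [hsq]
  linear_combination (-cos φ * a^2 * b^2) * hsc

lemma mul_sqrt_one_sub_ecc {a b : ℝ} (hb : 0 < b) (hba : b < a) (φ : ℝ) :
    a * √(1 - ecc a b ^ 2 * sin φ ^ 2) = ellipseSupport a b φ := by
  have ha : 0 < a := hb.trans hba
  have he : ecc a b ^ 2 = (a^2 - b^2) / a^2 := by
    rw [ecc, div_pow, Real.sq_sqrt (by nlinarith)]
  rw [ellipseSupport, show a^2 * cos φ^2 + b^2 * sin φ^2 = a^2 * (1 - ecc a b ^ 2 * sin φ ^ 2) by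
    rw [he, cos_sq']; field_simp; ring, Real.sqrt_mul (by positivity), Real.sqrt_sq ha.le]

lemma Ffun_eq {a b : ℝ} (hb : 0 < b) (hba : b < a) (r φ : ℝ) :
    Ffun a b r φ = 2*r^2*φ + 2*a*b*arctan ((b/a) * tan φ)
      - 4*r*(∫ θ in (0:ℝ)..φ, ellipseSupport a b θ)
      + r*(a^2 - b^2) * sin (2*φ) / ellipseSupport a b φ := by
  have ha : 0 < a := hb.trans hba
  have he : ecc a b ^ 2 = (a^2 - b^2) / a^2 := by
    rw [ecc, div_pow, Real.sq_sqrt (by nlinarith)]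
  have hp := ellipseSupport_pos ha hb φ
  have hq := mul_sqrt_one_sub_ecc hb hba φ
  have hE : (∫ θ in (0:ℝ)..φ, ellipseSupport a b θ) = a * Einc (ecc a b) φ := by
    rw [Einc, ← intervalIntegral.integral_const_mul]
    simp_rw [mul_sqrt_one_sub_ecc hb hba]
  have hq' : √(1 - ecc a b ^ 2 * sin φ ^ 2) = ellipseSupport a b φ / a := by
    rw [← hq]; field_simp
  rw [Ffun, hE, hq', he]
  field_simp

lemma hasDerivAt_Ffun {a b : ℝ} (hb : 0 < b) (hba : b < a) (r : ℝ) {φ : ℝ} (hc : cos φ ≠ 0) :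
    HasDerivAt (Ffun a b r)
      (2 * (r - a^2 * b^2 / ellipseSupport a b φ ^ 3) * (r - ellipseSupport a b φ)) φ := by
  have ha : 0 < a := hb.trans hba
  have hp := ellipseSupport_pos ha hb φ
  have hsq := sq_ellipseSupport a b φ
  have hsc := sin_sq_add_cos_sq φ
  rw [show Ffun a b r = _ from funext (Ffun_eq hb hba r)]
  have hI := (continuous_ellipseSupport a b).integral_hasStrictDerivAt 0 φ |>.hasDerivAt
  have hs2 : HasDerivAt (fun φ : ℝ => sin (2 * φ)) (cos (2 * φ) * (2 * 1)) φ :=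
    ((hasDerivAt_id φ).const_mul 2).sin
  have hA : HasDerivAt (fun φ => 2*a*b*arctan ((b/a) * tan φ))
      (2 * a^2 * b^2 / ellipseSupport a b φ ^ 2) φ := by
    refine ((((hasDerivAt_tan hc).const_mul (b/a)).arctan).const_mul (2*a*b)).congr_deriv ?_
    have h0 : a^2 * cos φ^2 + b^2 * sin φ^2 ≠ 0 := by rw [← hsq]; positivity
    rw [hsq, tan_eq_sin_div_cos]
    have h1 : 1 + (b / a * (sin φ / cos φ)) ^ 2
        = (a^2 * cos φ^2 + b^2 * sin φ^2) / (a^2 * cos φ^2) := by field_simp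
    rw [h1]; field_simp
  refine (((((hasDerivAt_id φ).const_mul (2*r^2)).add hA).sub (hI.const_mul (4*r))).add
    ((hs2.const_mul (r*(a^2 - b^2))).div (hasDerivAt_ellipseSupport ha hb φ)
      hp.ne')).congr_deriv ?_
  rw [sin_two_mul, cos_two_mul]
  have hid : ellipseSupport a b φ ^ 4 - a^2 * b^2
      = (a^2 - b^2) * (2 * cos φ^2 - 1) * ellipseSupport a b φ ^ 2
        + (a^2 - b^2)^2 * sin φ^2 * cos φ^2 := by
    rw [show ellipseSupport a b φ ^ 4 = (ellipseSupport a b φ ^ 2) ^ 2 by ring, hsq, sin_sq]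
    ring
  field_simp
  linear_combination (-2 * r) * hid

lemma ellipseSupport_neg (a b φ : ℝ) : ellipseSupport a b (-φ) = ellipseSupport a b φ := by
  simp [ellipseSupport]

lemma centerX_neg (a b r φ : ℝ) : centerX a b r (-φ) = centerX a b r φ := by
  simp [centerX, ellipseSupport_neg]

lemma centerY_neg (a b r φ : ℝ) : centerY a b r (-φ) = -centerY a b r φ := by
  simp only [centerY, ellipseSupport_neg, sin_neg]
  ring

lemma Ffun_neg {a b : ℝ} (hb : 0 < b) (hba : b < a) (r φ : ℝ) :
    Ffun a b r (-φ) = -Ffun a b r φ := by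
  have hI : (∫ θ in (0:ℝ)..(-φ), ellipseSupport a b θ) =
      -∫ θ in (0:ℝ)..φ, ellipseSupport a b θ := by
    have := intervalIntegral.integral_comp_neg (a := 0) (b := φ) (ellipseSupport a b)
    simp only [ellipseSupport_neg, neg_zero] at this
    rw [this, intervalIntegral.integral_symm]
  rw [Ffun_eq hb hba, Ffun_eq hb hba, hI, ellipseSupport_neg, mul_neg 2 φ, sin_neg, tan_neg,
    mul_neg (b / a), arctan_neg]
  ring

/-- The disk of radius `r` centered at `(u, v)` contains the ellipse, in coordinates. -/
def IsCenter (a b r u v : ℝ) : Prop :=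
  ∀ X Y : ℝ, X^2 / a^2 + Y^2 / b^2 ≤ 1 → (X - u)^2 + (Y - v)^2 ≤ r^2

lemma isCenter_centerY_iff {a b r : ℝ} (hb : 0 < b) (hba : b < a) (hr : 0 < r) {φ : ℝ}
    (hc : 0 ≤ cos φ) (hφ : a^2 / r ≤ ellipseSupport a b φ) (u : ℝ) :
    IsCenter a b r u (centerY a b r φ) ↔ |u| ≤ centerX a b r φ := by
  have ha : 0 < a := hb.trans hba
  have hp := ellipseSupport_pos ha hb φ
  have hsq := sq_ellipseSupport a b φ
  have hsc := sin_sq_add_cos_sq φ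
  constructor
  · intro h
    have key : ∀ t : ℝ, t^2 = 1 → (t * (a^2 * cos φ / ellipseSupport a b φ) + u)^2
        ≤ (r * cos φ)^2 := by
      intro t ht
      have := h (-t * (a^2 * cos φ / ellipseSupport a b φ)) (-(b^2 * sin φ / ellipseSupport a b φ))
        (by
          rw [mul_pow, neg_sq, neg_sq, ht]
          apply le_of_eq
          field_simp
          linarith)
      unfold centerY at this
      nlinarith [this]
    have hrc : 0 ≤ r * cos φ := by positivity
    have h1 := abs_le_of_sq_le_sq' (key 1 (by norm_num)) hrc
    have h2 := abs_le_of_sq_le_sq' (key (-1) (by norm_num)) hrc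
    rw [centerX, abs_le]
    constructor <;> linarith [h1.2, h2.1]
  · intro hu X Y hXY
    set h := ellipseSupport a b φ
    set G := centerX a b r φ with hG
    have hl : a^2 ≤ r * h := by rwa [div_le_iff₀' hr] at hφ
    have h1 : (X - u)^2 ≤ (|X| + G)^2 := by
      rw [sq_le_sq]
      calc |X - u| ≤ |X| + |u| := abs_sub _ _
        _ ≤ |X| + G := by linarith
        _ ≤ _ := le_abs_self _
    have hX : |X|^2 = X^2 := sq_abs X
    have e1 : 0 ≤ (r * h / a^2 - 1) * (|X| - a^2 * cos φ / h)^2 :=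
      mul_nonneg (by rw [sub_nonneg, one_le_div (by positivity)]; exact hl) (sq_nonneg _)
    have e2 : 0 ≤ (r * h / b^2 - 1) * (Y + b^2 * sin φ / h)^2 :=
      mul_nonneg (by rw [sub_nonneg, one_le_div (by positivity)]; nlinarith) (sq_nonneg _)
    have e3 : r * h * (X^2 / a^2 + Y^2 / b^2 - 1) ≤ 0 :=
      mul_nonpos_of_nonneg_of_nonpos (by positivity) (by linarith)
    have e4 : (|X| + G)^2 + (Y - centerY a b r φ)^2
        + (r * h / a^2 - 1) * (|X| - a^2 * cos φ / h)^2
        + (r * h / b^2 - 1) * (Y + b^2 * sin φ / h)^2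
        = r^2 + r * h * (X^2 / a^2 + Y^2 / b^2 - 1) := by
      rw [hG, centerX, centerY, ← hX]
      change (|X| + (r * cos φ - a^2 * cos φ / h))^2 + (Y - (r * sin φ - b^2 * sin φ / h))^2
        + _ + _ = _
      field_simp
      linear_combination (a^2 * b^2 * h^2 * r^2) * hsc + (a^2 * b^2 * h * r) * hsq
    linarith

lemma not_isCenter_of_centerY_lt {a b r : ℝ} (hb : 0 < b) (hba : b < a) (hr : 0 < r) {φ : ℝ}
    (hc : 0 ≤ cos φ) (hs : 0 ≤ sin φ) (hφ : ellipseSupport a b φ = a^2 / r) {u v : ℝ}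
    (hv : centerY a b r φ < |v|) : ¬ IsCenter a b r u v := by
  have ha : 0 < a := hb.trans hba
  have hp := ellipseSupport_pos ha hb φ
  have hsq := sq_ellipseSupport a b φ
  have hsc := sin_sq_add_cos_sq φ
  intro h
  have hX : a^2 * cos φ / ellipseSupport a b φ = r * cos φ := by rw [hφ]; field_simp
  obtain ⟨s, hs1, hsu⟩ : ∃ s : ℝ, s^2 = 1 ∧ s * |u| = u := by
    rcases abs_cases u with h | h
    · exact ⟨1, by norm_num, by linarith⟩
    · exact ⟨-1, by norm_num, by linarith⟩
  obtain ⟨t, ht1, htv⟩ : ∃ t : ℝ, t^2 = 1 ∧ t * |v| = v := by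
    rcases abs_cases v with h | h
    · exact ⟨1, by norm_num, by linarith⟩
    · exact ⟨-1, by norm_num, by linarith⟩
  have h1 := h (-s * (a^2 * cos φ / ellipseSupport a b φ))
    (-t * (b^2 * sin φ / ellipseSupport a b φ)) (by
      rw [mul_pow, neg_sq, hs1, mul_pow, neg_sq, ht1]
      apply le_of_eq
      field_simp
      linarith)
  rw [hX] at h1
  have e1 : (-s * (r * cos φ) - u)^2 = (r * cos φ + |u|)^2 := by
    rw [← hsu, abs_mul, abs_abs, show |s| = 1 by
      rw [← sq_eq_sq₀ (abs_nonneg _) zero_le_one, sq_abs, hs1, one_pow]]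
    linear_combination (r * cos φ + |u|)^2 * hs1
  have e2 : (-t * (b^2 * sin φ / ellipseSupport a b φ) - v)^2
      = (b^2 * sin φ / ellipseSupport a b φ + |v|)^2 := by
    rw [← htv, abs_mul, abs_abs, show |t| = 1 by
      rw [← sq_eq_sq₀ (abs_nonneg _) zero_le_one, sq_abs, ht1, one_pow]]
    linear_combination (b^2 * sin φ / ellipseSupport a b φ + |v|)^2 * ht1
  rw [e1, e2] at h1
  rw [centerY] at hv
  have h2 : (r * sin φ)^2 < (b^2 * sin φ / ellipseSupport a b φ + |v|)^2 :=
    pow_lt_pow_left₀ (by linarith) (by positivity) two_ne_zero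
  have h3 : (r * cos φ)^2 ≤ (r * cos φ + |u|)^2 :=
    pow_le_pow_left₀ (by positivity) (by linarith [abs_nonneg u]) 2
  nlinarith

lemma betaAng_mem {a b r : ℝ} (hb : 0 < b) (hba : b < a) (hr1 : a < r) (hr2 : r < a^2 / b) :
    0 < betaAng a b r ∧ betaAng a b r < π / 2 := by
  have ha : 0 < a := hb.trans hba
  have hr : 0 < r := ha.trans hr1
  refine ⟨?_, arctan_lt_pi_div_two _⟩
  rw [betaAng, ← arctan_zero]
  apply arctan_strictMono
  have h1 : 0 < r^2 - a^2 := by nlinarith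
  have h2 : 0 < a^4 - r^2*b^2 := by
    rw [lt_div_iff₀ hb] at hr2
    have := pow_lt_pow_left₀ hr2 (by positivity) two_ne_zero
    nlinarith
  positivity

lemma ellipseSupport_betaAng {a b r : ℝ} (hb : 0 < b) (hba : b < a) (hr1 : a < r)
    (hr2 : r < a^2 / b) : ellipseSupport a b (betaAng a b r) = a^2 / r := by
  have ha : 0 < a := hb.trans hba
  have hr : 0 < r := ha.trans hr1
  have h1 : 0 < r^2 - a^2 := by nlinarith
  have h2 : 0 < a^4 - r^2*b^2 := by
    rw [lt_div_iff₀ hb] at hr2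
    have := pow_lt_pow_left₀ hr2 (by positivity) two_ne_zero
    nlinarith
  have h3 : 0 < a^2 - b^2 := by nlinarith
  have hcos : cos (betaAng a b r) ^ 2 = (a^4 - r^2*b^2) / (r^2 * (a^2 - b^2)) := by
    rw [betaAng, cos_sq_arctan, div_pow, mul_pow, Real.sq_sqrt h1.le, Real.sq_sqrt h2.le]
    rw [div_eq_div_iff (by positivity) (by positivity)]
    field_simp
    ring
  rw [ellipseSupport, sin_sq, hcos, ← Real.sqrt_sq (show 0 ≤ a^2 / r by positivity)]
  congr 1
  field_simp
  ring

lemma div_le_ellipseSupport {a b r : ℝ} (hb : 0 < b) (hba : b < a) (hr1 : a < r)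
    (hr2 : r < a^2 / b) {φ : ℝ} (hφ : φ ∈ Icc (-betaAng a b r) (betaAng a b r)) :
    a^2 / r ≤ ellipseSupport a b φ := by
  have hβ := betaAng_mem hb hba hr1 hr2
  rw [← ellipseSupport_betaAng hb hba hr1 hr2]
  apply Real.sqrt_le_sqrt
  have hs : sin φ ^ 2 ≤ sin (betaAng a b r) ^ 2 := by
    apply sq_le_sq'
    · rw [← sin_neg]
      exact sin_le_sin_of_le_of_le_pi_div_two (by linarith) (by linarith [hφ.2]) hφ.1
    · exact sin_le_sin_of_le_of_le_pi_div_two (by linarith [hφ.1]) (by linarith) hφ.2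
  rw [cos_sq', cos_sq']
  nlinarith [mul_nonneg (show 0 ≤ a^2 - b^2 by nlinarith) (sub_nonneg.2 hs)]

lemma isCenter_iff_subset_closedBall {a b r : ℝ} (hr : 0 < r) (x : E2) :
    Kset a b ⊆ closedBall x r ↔ IsCenter a b r (x 0) (x 1) := by
  have hd : ∀ y : E2, y ∈ closedBall x r ↔ (y 0 - x 0)^2 + (y 1 - x 1)^2 ≤ r^2 := by
    intro y
    rw [mem_closedBall, EuclideanSpace.dist_eq, Real.sqrt_le_left hr.le, Fin.sum_univ_two,
      Real.dist_eq, Real.dist_eq, sq_abs, sq_abs]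
  constructor
  · intro h X Y hXY
    have := (hd !₂[X, Y]).1 (h (by simpa [Kset] using hXY))
    simpa using this
  · intro h y hy
    exact (hd y).2 (h _ _ hy)

lemma isClosed_setOf_isCenter (a b r : ℝ) :
    IsClosed {p : ℝ × ℝ | IsCenter a b r p.2 p.1} := by
  simp only [IsCenter, ofPred_forall]
  refine isClosed_iInter fun X => isClosed_iInter fun Y => isClosed_iInter fun _ => ?_
  exact isClosed_le (by fun_prop) (by fun_prop)

lemma volume_setOf_subset_closedBall {a b r : ℝ} (hr : 0 < r) :
    volume {x : E2 | Kset a b ⊆ closedBall x r} =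
      ∫⁻ v, volume {u : ℝ | IsCenter a b r u v} := by
  have hm := (isClosed_setOf_isCenter a b r).measurableSet
  have h1 : MeasurePreserving (fun x : E2 => (x 1, x 0)) volume volume :=
    Measure.measurePreserving_swap.comp ((volume_preserving_finTwoArrow ℝ).comp
      (PiLp.volume_preserving_ofLp (Fin 2)))
  have h2 : {x : E2 | Kset a b ⊆ closedBall x r} =
      (fun x : E2 => (x 1, x 0)) ⁻¹' {p : ℝ × ℝ | IsCenter a b r p.2 p.1} := by
    ext x
    exact isCenter_iff_subset_closedBall hr x
  rw [h2, h1.measure_preimage hm.nullMeasurableSet, Measure.volume_eq_prod,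
    Measure.prod_apply hm]
  rfl

/-- Case 4 of Lemma 1: for `a < r < a²/b`, the area of the set of centers `x` with
`K(a,b) ⊆ closedBall x r` is `F(β)`. -/
theorem area_ellipse_subset_ball_case4 (a b r : ℝ) (hb : 0 < b) (hba : b < a)
    (hr1 : a < r) (hr2 : r < a^2 / b) :
    volume {x : E2 | Kset a b ⊆ closedBall x r} =
      ENNReal.ofReal (Ffun a b r (betaAng a b r)) := by
  have ha : 0 < a := hb.trans hba
  have hr : 0 < r := ha.trans hr1
  obtain ⟨hβ0, hβ1⟩ := betaAng_mem hb hba hr1 hr2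
  have hh := @div_le_ellipseSupport a b r hb hba hr1 hr2
  have hhβ := ellipseSupport_betaAng hb hba hr1 hr2
  set β := betaAng a b r
  have hc : ∀ φ ∈ Icc (-β) β, 0 < cos φ := fun φ hφ =>
    cos_pos_of_mem_Ioo ⟨by linarith [hφ.1], by linarith [hφ.2]⟩
  have hk : ∀ φ ∈ Icc (-β) β, 0 < r - a^2 * b^2 / ellipseSupport a b φ ^ 3 := by
    intro φ hφ
    have h1 := pow_le_pow_left₀ (by positivity) (hh hφ) 3
    rw [lt_div_iff₀ hb] at hr2
    have h2 := pow_lt_pow_left₀ hr2 (by positivity) two_ne_zero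
    have h3 : a^2 * b^2 < r * (a^2 / r)^3 := by
      rw [show r * (a^2 / r)^3 = a^2 * (a^2)^2 / r^2 by field_simp, lt_div_iff₀ (by positivity)]
      nlinarith [mul_lt_mul_of_pos_left h2 (show 0 < a^2 by positivity)]
    rw [sub_pos, div_lt_iff₀ (pow_pos (ellipseSupport_pos ha hb φ) 3)]
    exact h3.trans_le (mul_le_mul_of_nonneg_left h1 hr.le)
  have hX : ∀ φ ∈ Icc (-β) β, 0 ≤ centerX a b r φ := by
    intro φ hφ
    have hp := ellipseSupport_pos ha hb φ
    have h1 := hh hφ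
    rw [div_le_iff₀ hr] at h1
    rw [centerX, sub_nonneg, div_le_iff₀ hp]
    nlinarith [mul_le_mul_of_nonneg_left h1 (hc φ hφ).le]
  have hXβ : centerX a b r β = 0 := by
    rw [centerX, hhβ]; field_simp; ring
  have hd : ∀ φ ∈ Icc (-β) β, HasDerivAt (centerY a b r)
      (cos φ * (r - a^2 * b^2 / ellipseSupport a b φ ^ 3)) φ := fun φ _ =>
    hasDerivAt_centerY ha hb r φ
  have hcont : ContinuousOn (centerY a b r) (Icc (-β) β) := fun φ hφ =>
    (hd φ hφ).continuousAt.continuousWithinAt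
  have hmono : StrictMonoOn (centerY a b r) (Icc (-β) β) := by
    apply strictMonoOn_of_deriv_pos (convex_Icc _ _) hcont
    intro φ hφ
    have hφ' := interior_subset hφ
    rw [(hd φ hφ').deriv]
    exact mul_pos (hc φ hφ') (hk φ hφ')
  have hsupp : (Function.support fun v => volume {u : ℝ | IsCenter a b r u v}) ⊆
      centerY a b r '' Icc (-β) β := by
    intro v hv
    by_contra hv'
    apply hv
    have hlt : centerY a b r β < |v| := by
      by_contra! hle
      apply hv'
      apply intermediate_value_Icc (by linarith) hcont
      rw [centerY_neg]
      exact abs_le.1 hle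
    have hβm : β ∈ Icc (-β) β := ⟨by linarith, le_rfl⟩
    have : {u : ℝ | IsCenter a b r u v} = ∅ := eq_empty_of_forall_notMem fun u =>
      not_isCenter_of_centerY_lt hb hba hr (hc β hβm).le
        (sin_nonneg_of_nonneg_of_le_pi hβ0.le (by linarith)) hhβ hlt
    simp [this]
  have hslice : ∀ φ ∈ Icc (-β) β, volume {u : ℝ | IsCenter a b r u (centerY a b r φ)} =
      ENNReal.ofReal (2 * centerX a b r φ) := by
    intro φ hφ
    have : {u : ℝ | IsCenter a b r u (centerY a b r φ)} =
        Icc (-centerX a b r φ) (centerX a b r φ) := by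
      ext u
      exact (isCenter_centerY_iff hb hba hr (hc φ hφ).le (hh hφ) u).trans abs_le
    rw [this, Real.volume_Icc]
    congr 1; ring
  have himg : MeasurableSet (centerY a b r '' Icc (-β) β) :=
    (isCompact_Icc.image_of_continuousOn hcont).measurableSet
  have hint : ContinuousOn (fun φ => cos φ * (r - a^2 * b^2 / ellipseSupport a b φ ^ 3) *
      (2 * centerX a b r φ)) (Icc (-β) β) := by
    intro φ _
    have h1 := (continuous_ellipseSupport a b).continuousAt (x := φ)
    have h2 := (hasDerivAt_centerX ha hb r φ).continuousAt
    have h3 : ellipseSupport a b φ ^ 3 ≠ 0 := (pow_pos (ellipseSupport_pos ha hb φ) 3).ne'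
    apply ContinuousAt.continuousWithinAt
    fun_prop (disch := assumption)
  have hprim : ∀ φ ∈ uIcc (-β) β,
      HasDerivAt (fun φ => Ffun a b r φ / 2 + centerX a b r φ * centerY a b r φ)
      (cos φ * (r - a^2 * b^2 / ellipseSupport a b φ ^ 3) * (2 * centerX a b r φ)) φ := by
    intro φ hφ
    rw [uIcc_of_le (by linarith)] at hφ
    have hp := ellipseSupport_pos ha hb φ
    refine (((hasDerivAt_Ffun hb hba r (hc φ hφ).ne').div_const 2).add
      ((hasDerivAt_centerX ha hb r φ).mul (hd φ hφ))).congr_deriv ?_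
    have key : r - ellipseSupport a b φ - sin φ * centerY a b r φ =
        cos φ * centerX a b r φ := by
      have hsq := sq_ellipseSupport a b φ
      have hsc := sin_sq_add_cos_sq φ
      rw [centerX, centerY]
      field_simp
      linear_combination (-r * ellipseSupport a b φ) * hsc - hsq
    linear_combination (r - a^2 * b^2 / ellipseSupport a b φ ^ 3) * key
  rw [volume_setOf_subset_closedBall hr, ← indicator_eq_self.2 hsupp, lintegral_indicator himg,
    lintegral_image_eq_lintegral_abs_deriv_mul measurableSet_Icc
      (fun φ hφ => (hd φ hφ).hasDerivWithinAt) hmono.injOn,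
    setLIntegral_congr_fun (g := fun φ => ENNReal.ofReal
      (cos φ * (r - a^2 * b^2 / ellipseSupport a b φ ^ 3) * (2 * centerX a b r φ)))
      measurableSet_Icc ?_,
    ← ofReal_integral_eq_lintegral_ofReal hint.integrableOn_Icc ?_, integral_Icc_eq_integral_Ioc,
    ← intervalIntegral.integral_of_le (by linarith),
    intervalIntegral.integral_eq_sub_of_hasDerivAt hprim ?_]
  · rw [Ffun_neg hb hba, centerX_neg, hXβ]
    congr 1; ring
  · exact (hint.mono (uIcc_of_le (by linarith)).subset).intervalIntegrable
  · filter_upwards [ae_restrict_mem measurableSet_Icc] with φ hφ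
    exact mul_nonneg (mul_pos (hc φ hφ) (hk φ hφ)).le (mul_nonneg zero_le_two (hX φ hφ))
  · intro φ hφ
    have h0 := mul_pos (hc φ hφ) (hk φ hφ)
    simp only
    rw [hslice φ hφ, abs_of_pos h0, ENNReal.ofReal_mul h0.le]
end
end
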